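/- There exists a constant C < ∞ such that for all integers n ≥ 1, all y ∈ B(n/2), and all ỹ ∈ B(8n), P(U(y, B(n))) ≤ C·P(U(ỹ, B(16n))). -/

import Mathlib

/-!
Critical site percolation on the triangular lattice realized on `ℤ²`.
A configuration assigns to each site `true` (open) or `false` (closed),
and `P` is the product Bernoulli(1/2) measure, axiomatized by
`IsBernoulliHalf` below (finite cylinder events have product probability).
-/

open MeasureTheory
open scoped ENNReal

/-- Sites of the lattice: vertices of `ℤ²`. -/
abbrev Site : Type := ℤ × ℤ

/-- A percolation configuration: `true` = open, `false` = closed. -/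
abbrev Config : Type := Site → Bool

/-- Adjacency for the triangular lattice realized on `ℤ²`:
the neighbors of `(x,y)` are `(x±1,y)`, `(x,y±1)`, `(x+1,y-1)`, `(x-1,y+1)`. -/
def Adj (a b : Site) : Prop :=
  (b.1 - a.1, b.2 - a.2) ∈
    ({(1, 0), (-1, 0), (0, 1), (0, -1), (1, -1), (-1, 1)} : Set (ℤ × ℤ))

/-- A (nonempty, self-avoiding) lattice path: a list of distinct sites in which
consecutive sites are neighbors. -/
def IsPath (p : List Site) : Prop := p ≠ [] ∧ p.Nodup ∧ p.Chain' Adj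

/-- A path all of whose vertices lie in the set `S`. -/
def PathIn (S : Set Site) (p : List Site) : Prop := IsPath p ∧ ∀ v ∈ p, v ∈ S

/-- All sites of `p` are open in `ω`. -/
def IsOpenOn (ω : Config) (p : List Site) : Prop := ∀ v ∈ p, ω v = true

/-- All sites of `p` are closed in `ω`. -/
def IsClosedOn (ω : Config) (p : List Site) : Prop := ∀ v ∈ p, ω v = false

/-- The first vertex of `p` lies in `A`. -/
def FirstIn (A : Set Site) (p : List Site) : Prop := ∃ a ∈ A, p.head? = some a

/-- The last vertex of `p` lies in `A`. -/
def LastIn (A : Set Site) (p : List Site) : Prop := ∃ a ∈ A, p.getLast? = some a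

/-- `μ` is the product Bernoulli(1/2) measure on configurations: a probability
measure for which every finite cylinder event has the product probability. -/
def IsBernoulliHalf (μ : Measure Config) : Prop :=
  IsProbabilityMeasure μ ∧
    ∀ (S : Finset Site) (f : Site → Bool),
      μ {ω | ∀ v ∈ S, ω v = f v} = (1 / 2 : ℝ≥0∞) ^ S.card

/-- The lattice rectangle `[x₀,x₁] × [y₀,y₁]`. -/
def rect (x₀ x₁ y₀ y₁ : ℤ) : Set Site :=
  {v | x₀ ≤ v.1 ∧ v.1 ≤ x₁ ∧ y₀ ≤ v.2 ∧ v.2 ≤ y₁}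

/-- The left side of a rectangle. -/
def rectLeft (x₀ x₁ y₀ y₁ : ℤ) : Set Site := {v ∈ rect x₀ x₁ y₀ y₁ | v.1 = x₀}

/-- The right side of a rectangle. -/
def rectRight (x₀ x₁ y₀ y₁ : ℤ) : Set Site := {v ∈ rect x₀ x₁ y₀ y₁ | v.1 = x₁}

/-- The top side of a rectangle. -/
def rectTop (x₀ x₁ y₀ y₁ : ℤ) : Set Site := {v ∈ rect x₀ x₁ y₀ y₁ | v.2 = y₁}

/-- The bottom side of a rectangle. -/
def rectBot (x₀ x₁ y₀ y₁ : ℤ) : Set Site := {v ∈ rect x₀ x₁ y₀ y₁ | v.2 = y₀}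

/-- A horizontal open crossing of the rectangle `[x₀,x₁] × [y₀,y₁]`:
an open path in the rectangle from its left side to its right side. -/
def HorizCrossing (x₀ x₁ y₀ y₁ : ℤ) (ω : Config) (p : List Site) : Prop :=
  PathIn (rect x₀ x₁ y₀ y₁) p ∧ IsOpenOn ω p ∧
    FirstIn (rectLeft x₀ x₁ y₀ y₁) p ∧ LastIn (rectRight x₀ x₁ y₀ y₁) p

/-- The set of sites of the rectangle lying on or beneath the path `q`: sites
that are on `q` or cannot be joined to the top side of the rectangle by a
lattice path avoiding `q`. -/
def OnOrBelow (x₀ x₁ y₀ y₁ : ℤ) (q : List Site) : Set Site :=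
  {v ∈ rect x₀ x₁ y₀ y₁ | v ∈ q ∨
    ¬ ∃ r : List Site, PathIn (rect x₀ x₁ y₀ y₁ \ {w | w ∈ q}) r ∧
        r.head? = some v ∧ LastIn (rectTop x₀ x₁ y₀ y₁) r}

/-- `p` is the lowest horizontal open crossing of the rectangle: it is a
horizontal open crossing lying on or beneath every horizontal open crossing. -/
def IsLowestCrossing (x₀ x₁ y₀ y₁ : ℤ) (ω : Config) (p : List Site) : Prop :=
  HorizCrossing x₀ x₁ y₀ y₁ ω p ∧
    ∀ q, HorizCrossing x₀ x₁ y₀ y₁ ω q → ∀ v ∈ p, v ∈ OnOrBelow x₀ x₁ y₀ y₁ q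

/-- `y` and `y + (1,0)` are the unique pair of neighboring sites of highest
vertical level on the path `p`: both belong to `p`, and every vertex of `p` of
maximal `y`-coordinate is one of them. -/
def HighestPair (p : List Site) (y : Site) : Prop :=
  y ∈ p ∧ (y.1 + 1, y.2) ∈ p ∧
    ∀ v ∈ p, v.2 ≤ y.2 ∧ (v.2 = y.2 → v = y ∨ v = (y.1 + 1, y.2))

namespace TriPerc

theorem adj_iff {a b : Site} : Adj a b ↔
    (b.1 = a.1 + 1 ∧ b.2 = a.2) ∨ (b.1 = a.1 - 1 ∧ b.2 = a.2) ∨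
    (b.1 = a.1 ∧ b.2 = a.2 + 1) ∨ (b.1 = a.1 ∧ b.2 = a.2 - 1) ∨
    (b.1 = a.1 + 1 ∧ b.2 = a.2 - 1) ∨ (b.1 = a.1 - 1 ∧ b.2 = a.2 + 1) := by
  simp only [Adj, Set.mem_insert_iff, Set.mem_singleton_iff, Prod.mk.injEq]
  omega

theorem adj_symm {a b : Site} (h : Adj a b) : Adj b a := by
  rw [adj_iff] at h ⊢; omega

/-- `Conn S a b`: the sites `a` and `b` are joined by a lattice walk inside `S`. -/
def Conn (S : Set Site) (a b : Site) : Prop :=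
  a ∈ S ∧ Relation.ReflTransGen (fun u v => Adj u v ∧ v ∈ S) a b

theorem Conn.refl {S : Set Site} {a : Site} (h : a ∈ S) : Conn S a a := ⟨h, .refl⟩

theorem Conn.step {S : Set Site} {a b c : Site} (h : Conn S a b) (hb : Adj b c) (hc : c ∈ S) :
    Conn S a c := ⟨h.1, h.2.tail ⟨hb, hc⟩⟩

@[elab_as_elim]
theorem Conn.induct {S : Set Site} {a b : Site} (h : Conn S a b) {p : Site → Prop} (h0 : p a)
    (hs : ∀ b c, Conn S a b → p b → Adj b c → c ∈ S → p c) : p b := by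
  obtain ⟨ha, h⟩ := h
  induction h with
  | refl => exact h0
  | tail h1 h2 ih => exact hs _ _ ⟨ha, h1⟩ ih h2.1 h2.2

theorem Conn.mem_right {S : Set Site} {a b : Site} (h : Conn S a b) : b ∈ S :=
  h.induct h.1 fun _ _ _ _ _ h => h

theorem Conn.trans {S : Set Site} {a b c : Site} (h : Conn S a b) (h' : Conn S b c) : Conn S a c :=
  ⟨h.1, h.2.trans h'.2⟩

theorem Conn.symm {S : Set Site} {a b : Site} (h : Conn S a b) : Conn S b a := by
  refine h.induct (Conn.refl h.1) fun b c h1 h2 h3 h4 => ?_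
  exact ((Conn.refl h4).step (adj_symm h3) h1.mem_right).trans h2

theorem Conn.mono {S T : Set Site} (hST : S ⊆ T) {a b : Site} (h : Conn S a b) : Conn T a b :=
  h.induct (Conn.refl (hST h.1)) fun _ _ _ h2 h3 h4 => h2.step h3 (hST h4)

/-- A walk that leaves `Y` has a first exit from `Y`. -/
theorem Conn.exists_exit {S Y : Set Site} {a b : Site} (h : Conn S a b) (ha : a ∈ Y) (hb : b ∉ Y) :
    ∃ u v, Conn (S ∩ Y) a u ∧ Adj u v ∧ v ∈ S ∧ v ∉ Y := by
  have key : Conn (S ∩ Y) a b ∨ ∃ u v, Conn (S ∩ Y) a u ∧ Adj u v ∧ v ∈ S ∧ v ∉ Y := by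
    refine h.induct (Or.inl (Conn.refl ⟨h.1, ha⟩)) fun b c _ h2 h3 h4 => ?_
    rcases h2 with h2 | h2
    · by_cases hc : c ∈ Y
      · exact Or.inl (h2.step h3 ⟨h4, hc⟩)
      · exact Or.inr ⟨b, c, h2, h3, h4, hc⟩
    · exact Or.inr h2
  rcases key with h | h
  · exact absurd h.mem_right.2 hb
  · exact h

/-- Image of a walk under an adjacency-preserving map. -/
theorem Conn.map {S T : Set Site} (f : Site → Site) (hf : ∀ a b, Adj a b → Adj (f a) (f b))
    (hST : ∀ v ∈ S, f v ∈ T) {a b : Site} (h : Conn S a b) : Conn T (f a) (f b) :=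
  h.induct (Conn.refl (hST _ h.1)) fun _ _ _ h2 h3 h4 => h2.step (hf _ _ h3) (hST _ h4)

/-- Straight walks: `k` steps in a lattice direction. -/
theorem Conn.line {S : Set Site} (a d : Site) (hd : Adj 0 d) (k : ℕ)
    (h : ∀ i : ℕ, i ≤ k → (a.1 + i * d.1, a.2 + i * d.2) ∈ S) :
    Conn S a (a.1 + k * d.1, a.2 + k * d.2) := by
  induction k with
  | zero => simpa using Conn.refl (by simpa using h 0 le_rfl)
  | succ k ih =>
    refine (ih fun i hi => h i (by omega)).step ?_ (h (k + 1) le_rfl)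
    rw [adj_iff] at hd ⊢
    push_cast
    simp only [Prod.fst_zero, Prod.snd_zero, add_mul, one_mul] at hd ⊢
    omega

/-- Walk along a row. -/
theorem Conn.row {S : Set Site} {x x' y : ℤ} (hx : x ≤ x')
    (h : ∀ t, x ≤ t → t ≤ x' → ((t, y) : Site) ∈ S) : Conn S (x, y) (x', y) := by
  have := Conn.line (S := S) (x, y) (1, 0) (by rw [adj_iff]; simp) (x' - x).toNat
    (fun i hi => by
      have := h (x + i) (by omega) (by omega)
      simpa using this)
  simpa [Int.toNat_of_nonneg (sub_nonneg.2 hx)] using this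

/-- Walk along a column. -/
theorem Conn.col {S : Set Site} {x y y' : ℤ} (hy : y ≤ y')
    (h : ∀ t, y ≤ t → t ≤ y' → ((x, t) : Site) ∈ S) : Conn S (x, y) (x, y') := by
  have := Conn.line (S := S) (x, y) (0, 1) (by rw [adj_iff]; simp) (y' - y).toNat
    (fun i hi => by
      have := h (y + i) (by omega) (by omega)
      simpa using this)
  simpa [Int.toNat_of_nonneg (sub_nonneg.2 hy)] using this

/-- Signed crossing, by the step `u → w`, of the vertical half-line above `v` and just to the
right of its column. -/
def ray (v u w : Site) : ℤ :=
  (if u.1 = v.1 ∧ w.1 = v.1 + 1 ∧ v.2 < u.2 then 1 else 0) -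
    (if u.1 = v.1 + 1 ∧ w.1 = v.1 ∧ v.2 < w.2 then 1 else 0)

/-- The correction term comparing the crossing numbers at the neighbours `v` and `v'`. -/
def gap (v v' u : Site) : ℤ :=
  if v'.1 = v.1 + 1 ∧ u.1 = v'.1 ∧ v'.2 < u.2 then 1 else 0

theorem ray_sub_ray {v v' u w : Site}
    (hv : (v'.1 = v.1 + 1 ∧ v'.2 = v.2) ∨ (v'.1 = v.1 ∧ v'.2 = v.2 + 1) ∨
      (v'.1 = v.1 + 1 ∧ v'.2 = v.2 - 1))
    (huw : Adj u w) (h1 : u ≠ v) (h2 : u ≠ v') (h3 : w ≠ v) (h4 : w ≠ v') :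
    ray v u w - ray v' u w = gap v v' w - gap v v' u := by
  obtain ⟨v1, v2⟩ := v
  obtain ⟨u1, u2⟩ := u
  obtain ⟨w1, w2⟩ := w
  obtain ⟨z1, z2⟩ := v'
  simp only [adj_iff, ne_eq, Prod.mk.injEq, ray, gap] at *
  rcases huw with ⟨rfl, rfl⟩ | ⟨rfl, rfl⟩ | ⟨rfl, rfl⟩ | ⟨rfl, rfl⟩ | ⟨rfl, rfl⟩ | ⟨rfl, rfl⟩ <;>
  rcases hv with ⟨rfl, rfl⟩ | ⟨rfl, rfl⟩ | ⟨rfl, rfl⟩ <;>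
  grind

/-- Crossing numbers of half-lines by a walk inside `P`. -/
theorem exists_crossing_number {P : Set Site} {s e : Site} (h : Conn P s e) :
    ∃ N : Site → ℤ,
      (∀ v v', ((v'.1 = v.1 + 1 ∧ v'.2 = v.2) ∨ (v'.1 = v.1 ∧ v'.2 = v.2 + 1) ∨
        (v'.1 = v.1 + 1 ∧ v'.2 = v.2 - 1)) → v ∉ P → v' ∉ P →
        N v - N v' = gap v v' e - gap v v' s) ∧
      (∀ v, (∀ u ∈ P, u.2 ≤ v.2) → N v = 0) ∧
      (∀ v, (∀ u ∈ P, v.2 < u.2) →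
        N v = (if v.1 < e.1 then 1 else 0) - (if v.1 < s.1 then 1 else 0)) := by
  refine h.induct ⟨fun _ => 0, by simp, by simp, by simp⟩ ?_
  rintro b c hb ⟨N, h1, h2, h3⟩ hbc hc
  have hbP := hb.mem_right
  refine ⟨fun v => N v + ray v b c, fun v v' hv hvP hvP' => ?_, fun v hv => ?_, fun v hv => ?_⟩
  · have := h1 v v' hv hvP hvP'
    have := ray_sub_ray hv hbc (fun h => hvP (h ▸ hbP)) (fun h => hvP' (h ▸ hbP))
      (fun h => hvP (h ▸ hc)) (fun h => hvP' (h ▸ hc))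
    simp only; omega
  · have hb' := hv b hbP
    have hc' := hv c hc
    have := h2 v hv
    simp only [this, ray]
    split_ifs <;> omega
  · have hb' := hv b hbP
    have hc' := hv c hc
    have := h3 v hv
    rw [adj_iff] at hbc
    simp only [this, ray]
    split_ifs <;> omega

/-- A walk crossing a strip from left to right and one crossing it from top to bottom meet. -/
theorem crossing_meet {P Q : Set Site} {a b c d : ℤ} (hP : ∀ v ∈ P, c ≤ v.2 ∧ v.2 ≤ d)
    (hQ : ∀ v ∈ Q, a ≤ v.1 ∧ v.1 ≤ b) {s e t u : Site} (hp : Conn P s e) (hs : s.1 < a)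
    (he : b < e.1) (hq : Conn Q t u) (ht : d ≤ t.2) (hu : u.2 < c) : ∃ v, v ∈ P ∧ v ∈ Q := by
  by_contra! hne
  obtain ⟨N, h1, h2, h3⟩ := exists_crossing_number hp
  have hdis : ∀ v ∈ Q, v ∉ P := fun v hv hv' => hne v hv' hv
  have g0 : ∀ v v' : Site, v' ∈ Q → gap v v' e - gap v v' s = 0 := by
    intro v v' hv'
    have := hQ v' hv'
    unfold gap
    split_ifs <;> omega
  have hconst : N u = N t := by
    refine hq.induct rfl fun b c hb ih hbc hc => ?_
    rw [← ih]
    have hbQ := hb.mem_right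
    have k1 := h1 b c
    have k2 := h1 c b
    have := g0 b c hc
    have := g0 c b hbQ
    rw [adj_iff] at hbc
    rcases hbc with h | h | h | h | h | h
    · have := k1 (by omega) (hdis _ hbQ) (hdis _ hc); omega
    · have := k2 (by omega) (hdis _ hc) (hdis _ hbQ); omega
    · have := k1 (by omega) (hdis _ hbQ) (hdis _ hc); omega
    · have := k2 (by omega) (hdis _ hc) (hdis _ hbQ); omega
    · have := k1 (by omega) (hdis _ hbQ) (hdis _ hc); omega
    · have := k2 (by omega) (hdis _ hc) (hdis _ hbQ); omega
  have ht0 := h2 t fun v hv => (hP v hv).2.trans ht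
  have hu1 := h3 u fun v hv => hu.trans_le (hP v hv).1
  have := hQ u hq.mem_right
  rw [if_pos (by omega), if_neg (by omega)] at hu1
  omega

/-- Left-right crossing of a rectangle by sites of `O`. -/
def HC (O : Set Site) (x₀ x₁ y₀ y₁ : ℤ) : Prop :=
  ∃ s e, Conn (O ∩ rect x₀ x₁ y₀ y₁) s e ∧ s.1 = x₀ ∧ e.1 = x₁

/-- Bottom-top crossing of a rectangle by sites of `O`. -/
def VC (O : Set Site) (x₀ x₁ y₀ y₁ : ℤ) : Prop :=
  ∃ s e, Conn (O ∩ rect x₀ x₁ y₀ y₁) s e ∧ s.2 = y₀ ∧ e.2 = y₁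

theorem HC.mono {O O' : Set Site} {x₀ x₁ y₀ y₁ : ℤ} (h : O ∩ rect x₀ x₁ y₀ y₁ ⊆ O')
    (hc : HC O x₀ x₁ y₀ y₁) : HC O' x₀ x₁ y₀ y₁ := by
  obtain ⟨s, e, hse, h1, h2⟩ := hc
  exact ⟨s, e, Conn.mono (T := O' ∩ rect x₀ x₁ y₀ y₁) (fun v hv => ⟨h hv, hv.2⟩) hse, h1, h2⟩

theorem VC.mono {O O' : Set Site} {x₀ x₁ y₀ y₁ : ℤ} (h : O ∩ rect x₀ x₁ y₀ y₁ ⊆ O')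
    (hc : VC O x₀ x₁ y₀ y₁) : VC O' x₀ x₁ y₀ y₁ := by
  obtain ⟨s, e, hse, h1, h2⟩ := hc
  exact ⟨s, e, Conn.mono (T := O' ∩ rect x₀ x₁ y₀ y₁) (fun v hv => ⟨h hv, hv.2⟩) hse, h1, h2⟩

theorem mem_rect {v : Site} {a b c d : ℤ} :
    v ∈ rect a b c d ↔ a ≤ v.1 ∧ v.1 ≤ b ∧ c ≤ v.2 ∧ v.2 ≤ d := Iff.rfl

theorem VC.extend {O : Set Site} {a b c d : ℤ} (h : VC O a b c d) :
    ∃ Q u t, Conn Q u t ∧ d ≤ u.2 ∧ t.2 < c ∧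
      ∀ v ∈ Q, a ≤ v.1 ∧ v.1 ≤ b ∧ (v ∈ O ∧ v ∈ rect a b c d ∨ v.2 < c) := by
  obtain ⟨t, u, htu, ht, hu⟩ := h
  have htr := mem_rect.1 htu.1.2
  refine ⟨O ∩ rect a b c d ∪ {(t.1, c - 1)}, u, (t.1, c - 1),
    (htu.symm.mono Set.subset_union_left).step ?_ (by simp), hu.ge, by simp, ?_⟩
  · rw [adj_iff]; grind
  · rintro v (hv | hv)
    · have := mem_rect.1 hv.2
      exact ⟨this.1, this.2.1, Or.inl hv⟩
    · obtain rfl : v = _ := hv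
      exact ⟨htr.1, htr.2.1, Or.inr (by simp)⟩

theorem HC.extend {O : Set Site} {a b c d : ℤ} (h : HC O a b c d) :
    ∃ P s e, Conn P s e ∧ s.1 < a ∧ b < e.1 ∧
      ∀ v ∈ P, c ≤ v.2 ∧ v.2 ≤ d ∧ (v ∈ O ∧ v ∈ rect a b c d ∨ v.1 < a ∨ b < v.1) := by
  obtain ⟨t, u, htu, ht, hu⟩ := h
  have htr := mem_rect.1 htu.1.2
  have hur := mem_rect.1 htu.mem_right.2
  refine ⟨O ∩ rect a b c d ∪ {(a - 1, t.2), (b + 1, u.2)}, (a - 1, t.2), (b + 1, u.2),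
    (Conn.trans ?_ (htu.mono Set.subset_union_left)).step ?_ (by simp), by simp, by simp, ?_⟩
  · refine (Conn.refl (by simp)).step ?_ (Or.inl htu.1)
    rw [adj_iff]; grind
  · rw [adj_iff]; grind
  · rintro v (hv | hv | hv)
    · have := mem_rect.1 hv.2
      exact ⟨this.2.2.1, this.2.2.2, Or.inl hv⟩
    · obtain rfl : v = _ := hv
      exact ⟨htr.2.2.1, htr.2.2.2, Or.inr (Or.inl (by simp))⟩
    · obtain rfl : v = _ := hv
      exact ⟨hur.2.2.1, hur.2.2.2, Or.inr (Or.inr (by simp))⟩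

theorem VC.blocks {O Q : Set Site} {a b c d : ℤ} (h : VC O a b c d)
    (hQ : ∀ v ∈ Q, c ≤ v.2 ∧ v.2 ≤ d) {s e : Site} (hse : Conn Q s e) (hs : s.1 < a)
    (he : b < e.1) : ∃ v ∈ rect a b c d, v ∈ O ∧ v ∈ Q := by
  obtain ⟨Q', u, t, hut, hu, ht, hQ'⟩ := h.extend
  obtain ⟨v, hv, hv'⟩ :=
    crossing_meet hQ (fun v hv => ⟨(hQ' v hv).1, (hQ' v hv).2.1⟩) hse hs he hut hu ht
  have := hQ v hv
  rcases (hQ' v hv').2.2 with h | h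
  · exact ⟨v, h.2, h.1, hv⟩
  · omega

theorem HC.blocks {O Q : Set Site} {a b c d : ℤ} (h : HC O a b c d)
    (hQ : ∀ v ∈ Q, a ≤ v.1 ∧ v.1 ≤ b) {s e : Site} (hse : Conn Q s e) (hs : d ≤ s.2)
    (he : e.2 < c) : ∃ v ∈ rect a b c d, v ∈ O ∧ v ∈ Q := by
  obtain ⟨P, t, u, htu, ht, hu, hP⟩ := h.extend
  obtain ⟨v, hv, hv'⟩ :=
    crossing_meet (fun v hv => ⟨(hP v hv).1, (hP v hv).2.1⟩) hQ htu ht hu hse hs he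
  have := hQ v hv'
  rcases (hP v hv).2.2 with h | h
  · exact ⟨v, h.2, h.1, hv'⟩
  · omega

theorem HC.meets_VC {O O' : Set Site} {a b c d : ℤ} (h : HC O a b c d) (h' : VC O' a b c d) :
    ∃ v ∈ rect a b c d, v ∈ O ∧ v ∈ O' := by
  obtain ⟨Q', u, t, hut, hu, ht, hQ'⟩ := h'.extend
  obtain ⟨v, hv, hvO, hv'⟩ := h.blocks (fun v hv => ⟨(hQ' v hv).1, (hQ' v hv).2.1⟩) hut hu ht
  have := mem_rect.1 hv
  rcases (hQ' v hv').2.2 with h | h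
  · exact ⟨v, hv, hvO, h.1⟩
  · omega

/-- The discrete one-form used in the proof of the Hex theorem, on the four labels
`0` (open, not joined to the left), `1` (open, joined to the left),
`2` (closed, not joined to the top), `3` (closed, joined to the top). -/
def hexForm (i j : Fin 4) : ℤ :=
  if i = 0 ∧ j = 2 then 1 else if i = 2 ∧ j = 0 then -1 else 0

/-- Labels that may occur at neighbouring sites. -/
def hexOk (i j : Fin 4) : Prop :=
  ¬ (i = 0 ∧ j = 1 ∨ i = 1 ∧ j = 0 ∨ i = 2 ∧ j = 3 ∨ i = 3 ∧ j = 2)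

instance (i j : Fin 4) : Decidable (hexOk i j) := by unfold hexOk; infer_instance

theorem hexForm_cell : ∀ i j k l : Fin 4, hexOk i j → hexOk i k → hexOk j k → hexOk j l →
    hexOk k l → hexForm i j + hexForm j l = hexForm i k + hexForm k l := by
  decide

theorem hexForm_bot : ∀ i j : Fin 4, hexOk i j → i ≠ 3 → j ≠ 3 →
    hexForm i j = (if i = 0 then 1 else 0) - (if j = 0 then 1 else 0) := by
  decide

theorem hexForm_right : ∀ i j : Fin 4, hexOk i j → i ≠ 1 → j ≠ 1 →
    hexForm i j = (if j = 2 then 1 else 0) - (if i = 2 then 1 else 0) := by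
  decide

theorem hexForm_top : ∀ i j : Fin 4, i ≠ 2 → j ≠ 2 → hexForm i j = 0 := by
  decide

theorem hexForm_left : ∀ i j : Fin 4, i ≠ 0 → j ≠ 0 → hexForm i j = 0 := by
  decide

/-- Sperner-type lemma: there is no labelling of a box with these constraints. -/
theorem hex_labelling (m n : ℕ) (l : ℕ → ℕ → Fin 4)
    (h1 : ∀ x y, x < m → y ≤ n → hexOk (l x y) (l (x + 1) y))
    (h2 : ∀ x y, x ≤ m → y < n → hexOk (l x y) (l x (y + 1)))
    (h3 : ∀ x y, x < m → y < n → hexOk (l (x + 1) y) (l x (y + 1)))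
    (hl : ∀ y, y ≤ n → l 0 y ≠ 0) (hr : ∀ y, y ≤ n → l m y ≠ 1)
    (ht : ∀ x, x ≤ m → l x n ≠ 2) (hb : ∀ x, x ≤ m → l x 0 ≠ 3) : False := by
  set S : ℕ → ℕ → ℤ := fun i y => ∑ x ∈ Finset.range i, hexForm (l x y) (l (x + 1) y) with hS
  have step : ∀ i y, i ≤ m → y < n →
      S i (y + 1) - S i y = hexForm (l i y) (l i (y + 1)) - hexForm (l 0 y) (l 0 (y + 1)) := by
    intro i y hi hy
    induction i with
    | zero => simp [hS]
    | succ i ih =>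
      have ih := ih (by omega)
      have := hexForm_cell (l i y) (l (i + 1) y) (l i (y + 1)) (l (i + 1) (y + 1))
        (h1 _ _ hi hy.le) (h2 _ _ (by omega) hy) (h3 _ _ hi hy) (h2 _ _ hi hy) (h1 _ _ hi hy)
      simp only [hS, Finset.sum_range_succ] at ih ⊢
      linarith
  have col : ∀ y, y ≤ n →
      S m y - (if l m y = 2 then 1 else 0) = S m 0 - (if l m 0 = 2 then 1 else 0) := by
    intro y hy
    induction y with
    | zero => rfl
    | succ y ih =>
      have ih := ih (by omega)
      have h := step m y le_rfl hy
      rw [hexForm_left _ _ (hl _ (by omega)) (hl _ hy),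
        hexForm_right _ _ (h2 _ _ le_rfl hy) (hr _ (by omega)) (hr _ hy)] at h
      linarith
  have bot : ∀ i, i ≤ m → S i 0 = (if l 0 0 = 0 then 1 else 0) - (if l i 0 = 0 then 1 else 0) := by
    intro i hi
    induction i with
    | zero => simp [hS]
    | succ i ih =>
      have ih := ih (by omega)
      have := hexForm_bot _ _ (h1 i 0 hi (by omega)) (hb _ (by omega)) (hb _ hi)
      simp only [hS, Finset.sum_range_succ] at ih ⊢
      linarith
  have top : S m n = 0 := Finset.sum_eq_zero fun x hx => by
    have := Finset.mem_range.1 hx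
    exact hexForm_top _ _ (ht _ (by omega)) (ht _ (by omega))
  have c := col n le_rfl
  rw [top, if_neg (ht m le_rfl), bot m le_rfl, if_neg (hl 0 (by omega))] at c
  have k1 := hr 0 (by omega)
  have k2 := hb m le_rfl
  generalize l m 0 = i at *
  revert k1 k2 c
  clear * -
  revert i
  decide

open Classical in
/-- The Hex theorem: a rectangle has a left-right crossing by sites of `O` or a bottom-top
crossing by sites outside `O`. -/
theorem hex (O : Set Site) {a b c d : ℤ} (hab : a ≤ b) (hcd : c ≤ d) :
    HC O a b c d ∨ VC Oᶜ a b c d := by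
  by_contra! ⟨hH, hV⟩
  set L : Site → Prop := fun v => ∃ s, s.1 = a ∧ Conn (O ∩ rect a b c d) s v
  set T : Site → Prop := fun v => ∃ s, s.2 = d ∧ Conn (Oᶜ ∩ rect a b c d) s v
  set l : Site → Fin 4 := fun v => if v ∈ O then (if L v then 1 else 0) else if T v then 3 else 2
    with hl
  have ok : ∀ u v, u ∈ rect a b c d → v ∈ rect a b c d → Adj u v → hexOk (l u) (l v) := by
    intro u v hu hv huv
    have e1 : u ∈ O → v ∈ O → (L u ↔ L v) := fun h h' =>
      ⟨fun ⟨s, hs, hc⟩ => ⟨s, hs, hc.step huv ⟨h', hv⟩⟩,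
        fun ⟨s, hs, hc⟩ => ⟨s, hs, hc.step (adj_symm huv) ⟨h, hu⟩⟩⟩
    have e2 : u ∉ O → v ∉ O → (T u ↔ T v) := fun h h' =>
      ⟨fun ⟨s, hs, hc⟩ => ⟨s, hs, hc.step huv ⟨h', hv⟩⟩,
        fun ⟨s, hs, hc⟩ => ⟨s, hs, hc.step (adj_symm huv) ⟨h, hu⟩⟩⟩
    by_cases h : u ∈ O <;> by_cases h' : v ∈ O
    · by_cases hL : L v <;> simp [hl, h, h', e1, hL, hexOk]
    · by_cases hL : L u <;> by_cases hT : T v <;> simp [hl, h, h', hL, hT, hexOk]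
    · by_cases hL : L v <;> by_cases hT : T u <;> simp [hl, h, h', hL, hT, hexOk]
    · by_cases hT : T v <;> simp [hl, h, h', e2, hT, hexOk]
  have mem : ∀ x y : ℕ, x ≤ (b - a).toNat → y ≤ (d - c).toNat →
      ((a + x, c + y) : Site) ∈ rect a b c d := by
    intro x y hx hy
    rw [mem_rect]; simp only; omega
  refine hex_labelling (b - a).toNat (d - c).toNat (fun x y => l (a + x, c + y))
    (fun x y hx hy => ok _ _ (mem _ _ hx.le hy) (mem _ _ hx hy) ?_)
    (fun x y hx hy => ok _ _ (mem _ _ hx hy.le) (mem _ _ hx hy) ?_)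
    (fun x y hx hy => ok _ _ (mem _ _ hx hy.le) (mem _ _ hx.le hy) ?_)
    (fun y hy h => ?_) (fun y hy h => ?_) (fun x hx h => ?_) (fun x hx h => ?_)
  · rw [adj_iff]; grind
  · rw [adj_iff]; grind
  · rw [adj_iff]; grind
  · have m := mem 0 y (by omega) hy
    have : l (a + (0 : ℕ), c + y) ≠ 0 := by
      by_cases h : (a + (0 : ℕ), c + (y : ℤ)) ∈ O
      · have : L (a + (0 : ℕ), c + y) := ⟨_, by simp, Conn.refl ⟨h, m⟩⟩
        simp only [hl, if_pos h, if_pos this]; decide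
      · simp only [hl, if_neg h]; split_ifs <;> decide
    exact this h
  · have m := mem _ y le_rfl hy
    simp only [hl] at h
    split_ifs at h with g1 g2 g3
    · obtain ⟨s, hs, hc⟩ := g2
      exact hH ⟨s, _, hc, hs, by simp only; omega⟩
    all_goals exact absurd h (by decide)
  · have m := mem x _ hx le_rfl
    simp only [hl] at h
    split_ifs at h with g1 g2 g3
    iterate 3 exact absurd h (by decide)
    exact g3 ⟨_, by simp only; omega, Conn.refl ⟨g1, m⟩⟩
  · have m := mem x 0 hx (by omega)
    simp only [hl] at h
    split_ifs at h with g1 g2 g3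
    iterate 2 exact absurd h (by decide)
    · obtain ⟨s, hs, hc⟩ := g3
      exact hV ⟨_, s, hc.symm, by simp, hs⟩
    exact absurd h (by decide)

/-- The open sites of a configuration. -/
def op (ω : Config) : Set Site := {v | ω v = true}

/-- The closed sites of a configuration. -/
def cl (ω : Config) : Set Site := {v | ω v = false}

/-- Events depending on the states of sites in `Λ` only. -/
def LocOn (Λ : Finset Site) (E : Set Config) : Prop :=
  ∀ ω ω' : Config, (∀ v ∈ Λ, ω v = ω' v) → ω ∈ E → ω' ∈ E

/-- Events depending on finitely many sites. -/
def IsLoc (E : Set Config) : Prop := ∃ Λ, LocOn Λ E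

theorem LocOn.mono {Λ Λ' : Finset Site} {E : Set Config} (h : LocOn Λ E) (hs : Λ ⊆ Λ') :
    LocOn Λ' E := fun ω ω' hv => h ω ω' fun v hv' => hv v (hs hv')

theorem IsLoc.inter {E F : Set Config} (hE : IsLoc E) (hF : IsLoc F) : IsLoc (E ∩ F) := by
  classical
  obtain ⟨Λ, hE⟩ := hE
  obtain ⟨Λ', hF⟩ := hF
  exact ⟨Λ ∪ Λ', fun ω ω' h hω =>
    ⟨hE.mono Finset.subset_union_left ω ω' h hω.1, hF.mono Finset.subset_union_right ω ω' h hω.2⟩⟩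

theorem isLoc_of_rect {E : Set Config} (a b c d : ℤ)
    (h : ∀ ω ω' : Config, (∀ v ∈ rect a b c d, ω v = ω' v) → ω ∈ E → ω' ∈ E) : IsLoc E := by
  refine ⟨Finset.Icc a b ×ˢ Finset.Icc c d, fun ω ω' hv => h ω ω' fun v hv' => hv v ?_⟩
  simp only [Finset.mem_product, Finset.mem_Icc]
  exact ⟨⟨hv'.1, hv'.2.1⟩, hv'.2.2⟩

open Classical in
/-- The configuration whose open sites are those of `s`. -/
noncomputable def cfg {Λ : Finset Site} (s : Finset Λ) : Config :=
  fun v => decide (∃ h : v ∈ Λ, (⟨v, h⟩ : Λ) ∈ s)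

/-- The open sites of `ω` in `Λ`. -/
def trace (Λ : Finset Site) (ω : Config) : Finset Λ :=
  Finset.univ.filter fun v => ω v = true

theorem cfg_trace {Λ : Finset Site} (ω : Config) {v : Site} (hv : v ∈ Λ) :
    cfg (trace Λ ω) v = ω v := by
  simp [cfg, trace, hv]

theorem cfg_off {Λ : Finset Site} (s : Finset Λ) {v : Site} (hv : v ∉ Λ) : cfg s v = false := by
  simp [cfg, hv]

theorem cfg_injective {Λ : Finset Site} : Function.Injective (cfg (Λ := Λ)) := by
  intro s t h
  ext ⟨v, hv⟩
  have := congrFun h v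
  simpa [cfg, hv] using this

theorem cfg_trace_of_off {Λ : Finset Site} (ω : Config) (h : ∀ v ∉ Λ, ω v = false) :
    cfg (trace Λ ω) = ω := by
  ext v
  by_cases hv : v ∈ Λ
  · rw [cfg_trace _ hv]
  · rw [cfg_off _ hv, h v hv]

open Classical in
/-- The configurations on `Λ` belonging to `E`. -/
noncomputable def cfgs (Λ : Finset Site) (E : Set Config) : Finset (Finset Λ) :=
  Finset.univ.filter fun s => cfg s ∈ E

theorem mem_cfgs {Λ : Finset Site} {E : Set Config} {s : Finset Λ} :
    s ∈ cfgs Λ E ↔ cfg s ∈ E := by simp [cfgs]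

theorem LocOn.trace_mem {Λ : Finset Site} {E : Set Config} (h : LocOn Λ E) {ω : Config} :
    trace Λ ω ∈ cfgs Λ E ↔ ω ∈ E := by
  rw [mem_cfgs]
  exact ⟨h _ _ fun v hv => cfg_trace ω hv, h _ _ fun v hv => (cfg_trace ω hv).symm⟩

theorem LocOn.eq_iUnion {Λ : Finset Site} {E : Set Config} (h : LocOn Λ E) :
    E = ⋃ s ∈ cfgs Λ E, {ω : Config | ∀ v ∈ Λ, ω v = cfg s v} := by
  ext ω
  simp only [Set.mem_iUnion, Set.mem_ofPred_eq, exists_prop]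
  refine ⟨fun hω => ⟨trace Λ ω, h.trace_mem.2 hω, fun v hv => (cfg_trace ω hv).symm⟩, ?_⟩
  rintro ⟨s, hs, hv⟩
  exact h _ _ (fun v hv' => (hv v hv').symm) (mem_cfgs.1 hs)

theorem measurableSet_cylinder (Λ : Finset Site) (f : Config) :
    MeasurableSet {ω : Config | ∀ v ∈ Λ, ω v = f v} := by
  have : {ω : Config | ∀ v ∈ Λ, ω v = f v} = ⋂ v ∈ Λ, (fun ω : Config => ω v) ⁻¹' {f v} := by
    ext; simp
  rw [this]
  exact Finset.measurableSet_biInter _ fun v _ => measurable_pi_apply v (measurableSet_singleton _)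

theorem IsLoc.measurableSet {E : Set Config} (h : IsLoc E) : MeasurableSet E := by
  obtain ⟨Λ, h⟩ := h
  rw [h.eq_iUnion]
  exact Finset.measurableSet_biUnion _ fun s _ => measurableSet_cylinder Λ _

theorem LocOn.measure_eq {μ : Measure Config} (hμ : IsBernoulliHalf μ) {Λ : Finset Site}
    {E : Set Config} (h : LocOn Λ E) : μ E = (cfgs Λ E).card * (1 / 2 : ℝ≥0∞) ^ Λ.card := by
  conv_lhs => rw [h.eq_iUnion]
  rw [measure_biUnion_finset]
  · rw [Finset.sum_congr rfl fun s _ => hμ.2 Λ (cfg s), Finset.sum_const, nsmul_eq_mul]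
  · intro s _ t _ hst
    refine Set.disjoint_left.2 fun ω hs ht => hst (cfg_injective ?_)
    ext v
    by_cases hv : v ∈ Λ
    · rw [← hs v hv, ← ht v hv]
    · rw [cfg_off _ hv, cfg_off _ hv]
  · exact fun s _ => measurableSet_cylinder Λ _

theorem IsLoc.measure_unique {μ ν : Measure Config} (hμ : IsBernoulliHalf μ)
    (hν : IsBernoulliHalf ν) {E : Set Config} (h : IsLoc E) : μ E = ν E := by
  obtain ⟨Λ, h⟩ := h
  rw [h.measure_eq hμ, h.measure_eq hν]

theorem two_pow_mul_half_pow (n : ℕ) : (2 : ℝ≥0∞) ^ n * (1 / 2) ^ n = 1 := by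
  rw [← mul_pow, one_div, ENNReal.mul_inv_cancel two_ne_zero ENNReal.ofNat_ne_top, one_pow]

/-- Relabelling sites and flipping all states preserves the measure. -/
theorem IsBernoulliHalf.measure_comp {μ : Measure Config} (hμ : IsBernoulliHalf μ)
    (σ : Site ≃ Site) (b : Bool) {E : Set Config} (h : IsLoc E) :
    μ {ω | (fun v => xor b (ω (σ v))) ∈ E} = μ E := by
  set Φ : Config → Config := fun ω v => xor b (ω (σ v)) with hΦ
  have hm : Measurable Φ := measurable_pi_lambda _ fun v =>
    (measurable_of_finite (fun c => xor b c)).comp (measurable_pi_apply (σ v))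
  have := hμ.1
  have hν : IsBernoulliHalf (μ.map Φ) := by
    refine ⟨Measure.isProbabilityMeasure_map hm.aemeasurable, fun S f => ?_⟩
    rw [Measure.map_apply hm (measurableSet_cylinder S f)]
    have := hμ.2 (S.map σ.toEmbedding) (fun v => xor b (f (σ.symm v)))
    rw [Finset.card_map] at this
    rw [← this]
    congr 1
    ext ω
    simp only [hΦ, Set.preimage_ofPred_eq, Set.mem_ofPred_eq, Finset.mem_map_equiv]
    constructor
    · intro h v hv
      have := h _ hv
      simp only [Equiv.apply_symm_apply] at this
      rw [← this]; cases b <;> simp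
    · intro h v hv
      have := h (σ v) (by simpa using hv)
      rw [this]; cases b <;> simp
  rw [← h.measure_unique hν hμ, Measure.map_apply hm h.measurableSet]
  rfl

theorem card_le_measure_le {μ : Measure Config} (hμ : IsBernoulliHalf μ) {Λ : Finset Site}
    {F G : Set Config} (hF : LocOn Λ F) (hG : LocOn Λ G)
    (h : (cfgs Λ F).card ≤ (cfgs Λ G).card) : μ F ≤ μ G := by
  rw [hF.measure_eq hμ, hG.measure_eq hμ]
  gcongr

theorem card_mul_le_measure_mul_le {μ : Measure Config} (hμ : IsBernoulliHalf μ) {Λ : Finset Site}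
    {F G T : Set Config} (hF : LocOn Λ F) (hG : LocOn Λ G) (hT : LocOn Λ T)
    (h : (cfgs Λ F).card * (cfgs Λ T).card ≤ 2 ^ Λ.card * (cfgs Λ G).card) :
    μ F * μ T ≤ μ G := by
  rw [hF.measure_eq hμ, hG.measure_eq hμ, hT.measure_eq hμ]
  have h' : ((cfgs Λ F).card : ℝ≥0∞) * (cfgs Λ T).card ≤ 2 ^ Λ.card * (cfgs Λ G).card := by
    exact_mod_cast h
  calc _ = ((cfgs Λ F).card * (cfgs Λ T).card : ℝ≥0∞) * ((1 / 2) ^ Λ.card * (1 / 2) ^ Λ.card) := by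
        ring
    _ ≤ (2 ^ Λ.card * (cfgs Λ G).card) * ((1 / 2) ^ Λ.card * (1 / 2) ^ Λ.card) := by gcongr
    _ = (2 ^ Λ.card * (1 / 2) ^ Λ.card) * ((cfgs Λ G).card * (1 / 2) ^ Λ.card) := by ring
    _ = _ := by rw [two_pow_mul_half_pow, one_mul]

/-- An injective map of configurations compares probabilities. -/
theorem measure_le_of_inj {μ : Measure Config} (hμ : IsBernoulliHalf μ) {Λ : Finset Site}
    {F G : Set Config} (hF : LocOn Λ F) (hG : LocOn Λ G) (Φ : Config → Config)
    (hΦ : ∀ ω ∈ F, Φ ω ∈ G)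
    (hinj : ∀ ω ω', (∀ v ∈ Λ, Φ ω v = Φ ω' v) → ∀ v ∈ Λ, ω v = ω' v) : μ F ≤ μ G := by
  refine card_le_measure_le hμ hF hG (Finset.card_le_card_of_injOn (fun s => trace Λ (Φ (cfg s)))
    (fun s hs => hG.trace_mem.2 (hΦ _ (mem_cfgs.1 hs))) ?_)
  intro s _ t _ hst
  refine cfg_injective (funext fun v => ?_)
  by_cases hv : v ∈ Λ
  · refine hinj _ _ (fun v hv => ?_) v hv
    rw [← cfg_trace (Φ (cfg s)) hv, ← cfg_trace (Φ (cfg t)) hv]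
    exact congrFun (congrArg cfg hst) v
  · rw [cfg_off _ hv, cfg_off _ hv]

open Classical in
/-- The configuration equal to `ω` on `S` and to `η` elsewhere. -/
noncomputable def mix (S : Set Site) (ω η : Config) : Config := fun v => if v ∈ S then ω v else η v

theorem mix_of_mem {S : Set Site} {ω η : Config} {v : Site} (h : v ∈ S) : mix S ω η v = ω v :=
  if_pos h

theorem mix_of_notMem {S : Set Site} {ω η : Config} {v : Site} (h : v ∉ S) :
    mix S ω η v = η v := if_neg h

/-- Resampling the sites outside a stopping set. -/
theorem resample {μ : Measure Config} (hμ : IsBernoulliHalf μ) {F T G : Set Config}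
    (hF : IsLoc F) (hT : IsLoc T) (hG : IsLoc G) (E : Config → Set Site)
    (hE : ∀ ω ω' : Config, (∀ v ∈ E ω, ω' v = ω v) → E ω' = E ω)
    (h : ∀ ω ∈ F, ∀ η ∈ T, mix (E ω) ω η ∈ G) : μ F * μ T ≤ μ G := by
  classical
  obtain ⟨Λ, hF', hT', hG'⟩ : ∃ Λ, LocOn Λ F ∧ LocOn Λ T ∧ LocOn Λ G := by
    obtain ⟨Λ₁, h₁⟩ := hF
    obtain ⟨Λ₂, h₂⟩ := hT
    obtain ⟨Λ₃, h₃⟩ := hG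
    exact ⟨Λ₁ ∪ Λ₂ ∪ Λ₃, h₁.mono (by grind), h₂.mono (by grind), h₃.mono (by grind)⟩
  refine card_mul_le_measure_mul_le hμ hF' hG' hT' ?_
  have hc : 2 ^ Λ.card = (Finset.univ : Finset (Finset Λ)).card := by
    simp [Fintype.card_finset]
  rw [hc, ← Finset.card_product, ← Finset.card_product]
  refine Finset.card_le_card_of_injOn
    (fun p => (trace Λ (mix (E (cfg p.1)) (cfg p.2) (cfg p.1)),
      trace Λ (mix (E (cfg p.1)) (cfg p.1) (cfg p.2)))) ?_ ?_
  · rintro ⟨s, t⟩ hst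
    have hst := Finset.mem_product.1 (Finset.mem_coe.1 hst)
    exact Finset.mem_coe.2 (Finset.mem_product.2 ⟨Finset.mem_univ _,
      hG'.trace_mem.2 (h _ (mem_cfgs.1 hst.1) _ (mem_cfgs.1 hst.2))⟩)
  · rintro ⟨s, t⟩ - ⟨s', t'⟩ - heq
    have off : ∀ (S : Set Site) (s t : Finset Λ), ∀ v ∉ Λ, mix S (cfg s) (cfg t) v = false := by
      intro S s t v hv
      simp [mix, cfg_off _ hv]
    have key := Prod.mk.inj heq
    simp only at key
    have k1 := congrArg cfg key.1
    have k2 := congrArg cfg key.2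
    rw [cfg_trace_of_off _ (off _ _ _), cfg_trace_of_off _ (off _ _ _)] at k1 k2
    have e1 := hE (cfg s) (mix (E (cfg s)) (cfg s) (cfg t)) fun v hv => mix_of_mem hv
    have e2 := hE (cfg s') (mix (E (cfg s')) (cfg s') (cfg t')) fun v hv => mix_of_mem hv
    have ee : E (cfg s) = E (cfg s') := by rw [← e1, ← e2, k2]
    have hs : cfg s = cfg s' := by
      funext v
      have a1 := congrFun k1 v
      have a2 := congrFun k2 v
      simp only [mix, ee] at a1 a2
      by_cases hv : v ∈ E (cfg s') <;> simp_all
    have ht : cfg t = cfg t' := by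
      funext v
      have a1 := congrFun k1 v
      have a2 := congrFun k2 v
      simp only [mix, ee] at a1 a2
      by_cases hv : v ∈ E (cfg s') <;> simp_all
    rw [cfg_injective hs, cfg_injective ht]

/-- Independence of events on disjoint sets of sites. -/
theorem indep {μ : Measure Config} (hμ : IsBernoulliHalf μ) {F T : Set Config}
    (hF : IsLoc F) (hT : IsLoc T) (S : Set Site)
    (hFS : ∀ ω ω' : Config, (∀ v ∈ S, ω v = ω' v) → ω ∈ F → ω' ∈ F)
    (hTS : ∀ ω ω' : Config, (∀ v ∉ S, ω v = ω' v) → ω ∈ T → ω' ∈ T) : μ F * μ T ≤ μ (F ∩ T) :=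
  resample hμ hF hT (hF.inter hT) (fun _ => S) (fun _ _ _ => rfl) fun ω hω η hη =>
    ⟨hFS ω _ (fun _ hv => (mix_of_mem hv).symm) hω,
      hTS η _ (fun _ hv => (mix_of_notMem hv).symm) hη⟩

/-- Increasing events. -/
def Inc (E : Set Config) : Prop := ∀ ω ω' : Config, op ω ⊆ op ω' → ω ∈ E → ω' ∈ E

theorem Inc.inter {E F : Set Config} (hE : Inc E) (hF : Inc F) : Inc (E ∩ F) :=
  fun ω ω' h hω => ⟨hE ω ω' h hω.1, hF ω ω' h hω.2⟩

/-- Harris' inequality. -/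
theorem harris {μ : Measure Config} (hμ : IsBernoulliHalf μ) {E F : Set Config}
    (hE : IsLoc E) (hF : IsLoc F) (iE : Inc E) (iF : Inc F) : μ E * μ F ≤ μ (E ∩ F) := by
  classical
  obtain ⟨Λ, hE', hF'⟩ : ∃ Λ, LocOn Λ E ∧ LocOn Λ F := by
    obtain ⟨Λ₁, h₁⟩ := hE
    obtain ⟨Λ₂, h₂⟩ := hF
    exact ⟨Λ₁ ∪ Λ₂, h₁.mono (by grind), h₂.mono (by grind)⟩
  have up : ∀ {G : Set Config}, Inc G → IsUpperSet (cfgs Λ G : Set (Finset Λ)) := by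
    intro G iG s t hst hs
    rw [Finset.mem_coe, mem_cfgs] at hs ⊢
    refine iG _ _ (fun v hv => ?_) hs
    simp only [op, cfg, Set.mem_ofPred_eq, decide_eq_true_eq] at hv ⊢
    obtain ⟨h, h'⟩ := hv
    exact ⟨h, hst h'⟩
  refine card_mul_le_measure_mul_le hμ hE' ?_ hF' ?_
  · exact fun ω ω' h hω => ⟨hE' ω ω' h hω.1, hF' ω ω' h hω.2⟩
  · have := (up iE).le_card_inter_finset (up iF)
    have e : cfgs Λ (E ∩ F) = cfgs Λ E ∩ cfgs Λ F := by
      ext s; simp [mem_cfgs]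
    rw [e]
    simpa using this

theorem Conn.cluster {S : Set Site} {a b : Site} (h : Conn S a b) :
    Conn {v | Conn S a v} a b :=
  h.induct (Conn.refl (Conn.refl h.1)) fun _ _ h1 h2 h3 h4 => h2.step h3 (h1.step h3 h4)

/-- A walk from the left of a rectangle to its right, inside its rows, contains a crossing. -/
theorem HC.of_conn {S : Set Site} {a b c d : ℤ} (hab : a ≤ b) {s e : Site} (h : Conn S s e)
    (hs : s.1 ≤ a) (he : b ≤ e.1) (hS : ∀ v ∈ S, c ≤ v.2 ∧ v.2 ≤ d) : HC S a b c d := by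
  obtain ⟨e', hse', he'⟩ : ∃ e', Conn (S ∩ {v | v.1 ≤ b}) s e' ∧ e'.1 = b := by
    by_cases hsb : s.1 = b
    · exact ⟨s, Conn.refl ⟨h.1, hsb.le⟩, hsb⟩
    · obtain ⟨u, v, h1, h2, h3, h4⟩ := h.exists_exit (Y := {v | v.1 < b})
        (show s.1 < b by omega) (show ¬ e.1 < b by omega)
      have hu : u.1 < b := h1.mem_right.2
      have hv : ¬ v.1 < b := h4
      have hv' : v.1 = b := by rw [adj_iff] at h2; omega
      refine ⟨v, (h1.mono ?_).step h2 ⟨h3, hv'.le⟩, hv'⟩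
      exact fun w hw => ⟨hw.1, (show w.1 < b from hw.2).le⟩
  have hrect : ∀ v, v ∈ S ∩ {v : Site | v.1 ≤ b} → a ≤ v.1 → v ∈ S ∩ rect a b c d :=
    fun v hv ha => ⟨hv.1, ha, hv.2, hS v hv.1⟩
  by_cases hea : e'.1 = a
  · exact ⟨e', e', Conn.refl (hrect _ hse'.mem_right hea.ge), hea, he'⟩
  · obtain ⟨u, v, h1, h2, h3, h4⟩ := hse'.symm.exists_exit (Y := {v | a < v.1})
      (show a < e'.1 by omega) (show ¬ a < s.1 by omega)
    have hu : a < u.1 := h1.mem_right.2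
    have hv : ¬ a < v.1 := h4
    have hv' : v.1 = a := by rw [adj_iff] at h2; omega
    refine ⟨v, e', ((h1.mono ?_).step h2 (hrect _ h3 hv'.ge)).symm, hv', he'⟩
    exact fun w hw => hrect w hw.1 (show a < w.1 from hw.2).le

theorem Conn.swap {S : Set Site} {a b : Site} (h : Conn S a b) :
    Conn (Prod.swap ⁻¹' S) a.swap b.swap :=
  h.map Prod.swap (fun a b h => by
    rw [adj_iff] at h ⊢; simp only [Prod.fst_swap, Prod.snd_swap]; omega)
    fun v hv => by simpa using hv

theorem hc_swap {O : Set Site} {a b c d : ℤ} :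
    HC (Prod.swap ⁻¹' O) c d a b ↔ VC O a b c d := by
  constructor
  · rintro ⟨s, e, h, hs, he⟩
    refine ⟨s.swap, e.swap, h.swap.mono ?_, hs, he⟩
    rintro ⟨x, y⟩ ⟨h1, h2⟩
    have := mem_rect.1 h2
    exact ⟨h1, this.2.2.1, this.2.2.2, this.1, this.2.1⟩
  · rintro ⟨s, e, h, hs, he⟩
    refine ⟨s.swap, e.swap, h.swap.mono ?_, hs, he⟩
    rintro ⟨x, y⟩ ⟨h1, h2⟩
    have := mem_rect.1 h2
    exact ⟨h1, this.2.2.1, this.2.2.2, this.1, this.2.1⟩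

theorem VC.of_conn {S : Set Site} {a b c d : ℤ} (hcd : c ≤ d) {s e : Site} (h : Conn S s e)
    (hs : s.2 ≤ c) (he : d ≤ e.2) (hS : ∀ v ∈ S, a ≤ v.1 ∧ v.1 ≤ b) : VC S a b c d :=
  hc_swap.1 (HC.of_conn hcd h.swap hs he fun _ hv => hS _ hv)

/-- The trapezoid with horizontal sides in the rows `0` and `2k`, bounded by the column `0` and
the antidiagonal `x + y = M`. -/
def trap (k M : ℤ) : Set Site := {v | 0 ≤ v.2 ∧ v.2 ≤ 2 * k ∧ 0 ≤ v.1 ∧ v.1 + v.2 ≤ M}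

theorem mem_trap {k M : ℤ} {v : Site} :
    v ∈ trap k M ↔ 0 ≤ v.2 ∧ v.2 ≤ 2 * k ∧ 0 ≤ v.1 ∧ v.1 + v.2 ≤ M := Iff.rfl

/-- Hex theorem for a trapezoid with four marked boundary arcs. -/
theorem trap_hex (O : Set Site) {k j r : ℤ} (hk : 0 ≤ k) (hkj : k ≤ j) (hr : 0 ≤ r)
    (hrj : r ≤ j + 1) :
    (∃ s e, Conn (O ∩ trap k (2 * j)) s e ∧ (s.1 = 0 ∨ s.2 = 0 ∧ s.1 < r) ∧
      e.2 = 2 * k ∧ j - k ≤ e.1) ∨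
    (∃ s e, Conn (Oᶜ ∩ trap k (2 * j)) s e ∧ s.2 = 2 * k ∧ s.1 ≤ j - k ∧
      (e.1 + e.2 = 2 * j ∨ e.2 = 0 ∧ r - 1 ≤ e.1)) := by
  set D := trap k (2 * j) with hD
  set O' : Set Site := {v | (v ∈ D ∧ v ∈ O) ∨ (v.1 = -1 ∧ 0 ≤ v.2 ∧ v.2 ≤ 2 * k) ∨
    (v.2 = -1 ∧ v.1 < r) ∨ (v.2 = 2 * k + 1 ∧ j - k ≤ v.1)} with hO'
  have memO' : ∀ v, v ∈ O' ↔ (v ∈ D ∧ v ∈ O) ∨ (v.1 = -1 ∧ 0 ≤ v.2 ∧ v.2 ≤ 2 * k) ∨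
    (v.2 = -1 ∧ v.1 < r) ∨ (v.2 = 2 * k + 1 ∧ j - k ≤ v.1) := fun _ => Iff.rfl
  rcases hex O' (a := -1) (b := 2 * j + 1) (c := -1) (d := 2 * k + 1) (by omega) (by omega)
    with ⟨s, e, h, hs, he⟩ | ⟨s, e, h, hs, he⟩
  · left
    by_contra hno
    have key : (e.1 = -1 ∧ e.2 ≤ 2 * k) ∨ (e.2 = -1 ∧ e.1 < r) ∨
        ∃ s, Conn (O ∩ D) s e ∧ (s.1 = 0 ∨ s.2 = 0 ∧ s.1 < r) := by
      refine h.induct (p := fun e => (e.1 = -1 ∧ e.2 ≤ 2 * k) ∨ (e.2 = -1 ∧ e.1 < r) ∨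
        ∃ s, Conn (O ∩ D) s e ∧ (s.1 = 0 ∨ s.2 = 0 ∧ s.1 < r)) ?_ ?_
      · have h1 := (memO' s).1 h.1.1
        have h2 := mem_rect.1 h.1.2
        have h3 := mem_trap (k := k) (M := 2 * j) (v := s)
        rw [← hD] at h3
        left
        by_contra
        have : s ∉ D := by rw [h3]; omega
        simp only [this, false_and, false_or] at h1
        omega
      · intro b c hb ih hbc hc
        have h1 := (memO' c).1 hc.1
        have h2 := mem_rect.1 hc.2
        have h2b := mem_rect.1 hb.mem_right.2
        rw [adj_iff] at hbc
        rcases h1 with h1 | h1 | h1 | h1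
        · have h3 := mem_trap.1 h1.1
          rcases ih with ih | ih | ⟨s, hs, hs'⟩
          · exact Or.inr (Or.inr ⟨c, Conn.refl ⟨h1.2, h1.1⟩, by omega⟩)
          · exact Or.inr (Or.inr ⟨c, Conn.refl ⟨h1.2, h1.1⟩, by omega⟩)
          · exact Or.inr (Or.inr ⟨s, hs.step (adj_iff.2 hbc) ⟨h1.2, h1.1⟩, hs'⟩)
        · exact Or.inl ⟨h1.1, h1.2.2⟩
        · exact Or.inr (Or.inl h1)
        · rcases ih with ih | ih | ⟨s, hs, hs'⟩
          · omega
          · omega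
          · have h3 := mem_trap.1 hs.mem_right.2
            exact absurd ⟨s, b, hs, hs', by omega, by omega⟩ hno
    have h1 := (memO' e).1 h.mem_right.1
    rcases key with key | key | ⟨s', hs', -⟩
    · omega
    · omega
    · have := mem_trap.1 hs'.mem_right.2
      omega
  · right
    by_contra hno
    have key : (s.2 = 2 * k + 1 ∧ s.1 < j - k) ∨
        ∃ t, Conn (Oᶜ ∩ D) t s ∧ t.2 = 2 * k ∧ t.1 ≤ j - k := by
      refine h.symm.induct (p := fun s => (s.2 = 2 * k + 1 ∧ s.1 < j - k) ∨
        ∃ t, Conn (Oᶜ ∩ D) t s ∧ t.2 = 2 * k ∧ t.1 ≤ j - k) ?_ ?_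
      · have h1 := mt (memO' e).2 h.mem_right.1
        left
        by_contra
        exact h1 (Or.inr (Or.inr (Or.inr ⟨by omega, by omega⟩)))
      · intro b c hb ih hbc hc
        have h1 := mt (memO' c).2 hc.1
        have h2 := mem_rect.1 hc.2
        have h2b := mem_rect.1 hb.mem_right.2
        rw [adj_iff] at hbc
        by_cases hcD : c ∈ D
        · have h3 := mem_trap.1 hcD
          have hcO : c ∈ Oᶜ ∩ D := ⟨fun h => h1 (Or.inl ⟨hcD, h⟩), hcD⟩
          rcases ih with ih | ⟨t, ht, ht'⟩
          · exact Or.inr ⟨c, Conn.refl hcO, by omega, by omega⟩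
          · exact Or.inr ⟨t, ht.step (adj_iff.2 hbc) hcO, ht'⟩
        · have h3 := mt mem_trap.2 hcD
          have h4 : ¬ ((c.1 = -1 ∧ 0 ≤ c.2 ∧ c.2 ≤ 2 * k) ∨
            (c.2 = -1 ∧ c.1 < r) ∨ (c.2 = 2 * k + 1 ∧ j - k ≤ c.1)) := fun h => h1 (Or.inr h)
          rcases ih with ih | ⟨t, ht, ht'⟩
          · left; omega
          · have h5 := mem_trap.1 ht.mem_right.2
            by_cases hc2 : c.2 = 2 * k + 1
            · left; omega
            · exact absurd ⟨t, b, ht, ht'.1, ht'.2, by omega⟩ hno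
    rcases key with key | ⟨t, ht, -⟩
    · omega
    · have := mem_trap.1 ht.mem_right.2
      omega

set_option maxHeartbeats 1000000 in
/-- Two walks in a trapezoid joining alternating boundary arcs meet. -/
theorem trap_meet {P Q : Set Site} {k j : ℤ}
    (hP : P ⊆ trap k (2 * j)) (hQ : Q ⊆ trap k (2 * j)) {s e t u : Site} (hp : Conn P s e)
    (hs : s.1 = 0 ∨ s.2 = 0 ∧ s.1 ≤ j) (he : e.2 = 2 * k) (he' : j - k ≤ e.1) (hq : Conn Q t u)
    (ht : t.2 = 2 * k) (ht' : t.1 ≤ j - k) (hu : u.1 + u.2 = 2 * j ∨ u.2 = 0 ∧ j ≤ u.1) :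
    ∃ v, v ∈ P ∧ v ∈ Q := by
  by_contra! hne
  have hte : t.1 < e.1 := by
    by_contra
    exact hne e hp.mem_right ((Prod.ext (by omega) (by omega) : e = t) ▸ hq.1)
  have hsD := mem_trap.1 (hP hp.1)
  have heD := mem_trap.1 (hP hp.mem_right)
  have htD := mem_trap.1 (hQ hq.1)
  have huD := mem_trap.1 (hQ hq.mem_right)
  obtain ⟨P₁, s', hP₁, hs', hP₁'⟩ : ∃ P₁ s', Conn P₁ s' e ∧ s'.1 = -1 ∧ ∀ v ∈ P₁, v ∈ P ∨
      (v.1 = -1 ∧ 0 ≤ v.2 ∧ v.2 ≤ 2 * k) ∨ (v.2 = -1 ∧ s.2 = 0 ∧ s.1 ≤ j ∧ v.1 ≤ s.1) := by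
    rcases hs with hs | hs
    · refine ⟨P ∪ {(-1, s.2)}, (-1, s.2), ((Conn.refl (by simp)).step ?_ (Or.inl hp.1)).trans
        (hp.mono Set.subset_union_left), rfl, ?_⟩
      · rw [adj_iff]; grind
      · rintro v (hv | hv)
        · exact Or.inl hv
        · obtain rfl : v = _ := hv
          exact Or.inr (Or.inl ⟨rfl, hsD.1, hsD.2.1⟩)
    · refine ⟨P ∪ {v | v.2 = -1 ∧ v.1 ≤ s.1}, (-1, -1), ((Conn.row (x' := s.1) (by omega)
        fun t h1 h2 => Or.inr ⟨rfl, h2⟩).step ?_ (Or.inl hp.1)).trans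
        (hp.mono Set.subset_union_left), rfl, ?_⟩
      · rw [adj_iff]; grind
      · rintro v (hv | hv)
        · exact Or.inl hv
        · exact Or.inr (Or.inr ⟨hv.1, hs.1, hs.2, hv.2⟩)
  obtain ⟨Q₁, u', hQ₁, hu', hQ₁'⟩ : ∃ Q₁ u', Conn Q₁ t u' ∧ u'.2 = -2 ∧ ∀ v ∈ Q₁, v ∈ Q ∨
      (v.1 + v.2 = 2 * j + 1 ∧ -2 ≤ v.2 ∧ v.2 ≤ 2 * k) ∨
      (v.1 = u.1 ∧ v.2 < 0 ∧ -2 ≤ v.2 ∧ u.2 = 0 ∧ j ≤ u.1) := by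
    rcases hu with hu | hu
    · refine ⟨Q ∪ {v | v.1 + v.2 = 2 * j + 1 ∧ -2 ≤ v.2 ∧ v.2 ≤ 2 * k}, _,
        ((hq.mono Set.subset_union_left).step (c := (u.1 + 1, u.2)) ?_ (Or.inr ?_)).trans
          (Conn.line _ (1, -1) ?_ (u.2 + 2).toNat fun i hi => Or.inr ?_), ?_, fun v hv => ?_⟩
      · rw [adj_iff]; grind
      · simp only [Set.mem_ofPred_eq]; omega
      · rw [adj_iff]; simp
      · simp only [Set.mem_ofPred_eq]; omega
      · simp only; omega
      · rcases hv with hv | hv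
        · exact Or.inl hv
        · exact Or.inr (Or.inl hv)
    · refine ⟨Q ∪ {v | v.1 = u.1 ∧ v.2 < 0 ∧ -2 ≤ v.2}, (u.1, -2),
        ((hq.mono Set.subset_union_left).step (c := (u.1, -1)) ?_ (Or.inr ?_)).step ?_ (Or.inr ?_),
        rfl, fun v hv => ?_⟩
      · rw [adj_iff]; grind
      · simp
      · rw [adj_iff]; simp
      · simp
      · rcases hv with hv | hv
        · exact Or.inl hv
        · exact Or.inr (Or.inr ⟨hv.1, hv.2.1, hv.2.2, hu⟩)
  have hp' : Conn (P₁ ∪ {v | v.2 = 2 * k + 1 ∧ e.1 ≤ v.1}) s' (2 * j + 5, 2 * k + 1) := by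
    refine ((hP₁.mono Set.subset_union_left).step (c := (e.1, 2 * k + 1)) ?_ (Or.inr ?_)).trans
      (Conn.row (by omega) fun t h1 h2 => Or.inr ?_)
    · rw [adj_iff]; grind
    · exact ⟨rfl, le_rfl⟩
    · exact ⟨rfl, h1⟩
  have hq' : Conn (Q₁ ∪ {(t.1, 2 * k + 1)}) (t.1, 2 * k + 1) u' := by
    refine ((Conn.refl (by simp)).step ?_ (Or.inl hQ₁.1)).trans (hQ₁.mono Set.subset_union_left)
    rw [adj_iff]; grind
  obtain ⟨v, hv, hv'⟩ := crossing_meet (a := 0) (b := 2 * j + 4) (c := -1) (d := 2 * k + 1) (by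
    rintro v (hv | hv)
    · rcases hP₁' v hv with h | h
      · have := mem_trap.1 (hP h); omega
      · omega
    · have := hv.1; omega) (by
    rintro v (hv | hv)
    · rcases hQ₁' v hv with h | h
      · have := mem_trap.1 (hQ h); omega
      · omega
    · obtain rfl : v = _ := hv
      simp only; omega) hp' (by omega) (by simp) hq' le_rfl (by omega)
  have e1 : v ∈ P ∨ (v.1 = -1 ∧ 0 ≤ v.2 ∧ v.2 ≤ 2 * k) ∨
      (v.2 = -1 ∧ s.2 = 0 ∧ s.1 ≤ j ∧ v.1 ≤ s.1) ∨ (v.2 = 2 * k + 1 ∧ e.1 ≤ v.1) := by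
    rcases hv with hv | hv
    · rcases hP₁' v hv with h | h | h
      exacts [Or.inl h, Or.inr (Or.inl h), Or.inr (Or.inr (Or.inl h))]
    · exact Or.inr (Or.inr (Or.inr hv))
  have e2 : v ∈ Q ∨ (v.1 + v.2 = 2 * j + 1 ∧ -2 ≤ v.2 ∧ v.2 ≤ 2 * k) ∨
      (v.1 = u.1 ∧ v.2 < 0 ∧ -2 ≤ v.2 ∧ u.2 = 0 ∧ j ≤ u.1) ∨
      (v.1 = t.1 ∧ v.2 = 2 * k + 1) := by
    rcases hv' with hv | hv
    · rcases hQ₁' v hv with h | h | h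
      exacts [Or.inl h, Or.inr (Or.inl h), Or.inr (Or.inr (Or.inl h))]
    · obtain rfl : v = _ := hv
      exact Or.inr (Or.inr (Or.inr ⟨rfl, rfl⟩))
  have hsu : s.2 = 0 → u.2 = 0 → s.1 ≤ j → j ≤ u.1 → s.1 < u.1 := by
    intro h1 h2 h3 h4
    by_contra
    exact hne s hp.1 ((Prod.ext (by omega) (by omega) : s = u) ▸ hq.mem_right)
  rcases e1 with e1 | e1 <;> rcases e2 with e2 | e2
  · exact hne v e1 e2
  · have := mem_trap.1 (hP e1); omega
  · have := mem_trap.1 (hQ e2); omega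
  · omega

/-- The closed cluster of `Z` inside `S`. -/
def clu (S Z : Set Site) (ω : Config) : Set Site := {v | ∃ z ∈ Z, Conn (cl ω ∩ S) z v}

/-- The sites that have to be examined to determine the closed cluster of `Z` inside `S`. -/
def expl (S Z : Set Site) (ω : Config) : Set Site :=
  {v | v ∈ S ∧ (v ∈ Z ∨ v ∈ clu S Z ω ∨ ∃ u ∈ clu S Z ω, Adj u v)}

theorem clu_subset {S Z : Set Site} {ω : Config} {v : Site} (h : v ∈ clu S Z ω) :
    v ∈ S ∧ ω v = false := by
  obtain ⟨z, -, h⟩ := h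
  exact ⟨h.mem_right.2, h.mem_right.1⟩

theorem clu_step {S Z : Set Site} {ω : Config} {u v : Site} (h : u ∈ clu S Z ω) (huv : Adj u v)
    (hv : v ∈ S) (hc : ω v = false) : v ∈ clu S Z ω := by
  obtain ⟨z, hz, h⟩ := h
  exact ⟨z, hz, h.step huv ⟨hc, hv⟩⟩

theorem clu_start {S Z : Set Site} {ω : Config} {v : Site} (hz : v ∈ Z) (hv : v ∈ S)
    (hc : ω v = false) : v ∈ clu S Z ω := ⟨v, hz, Conn.refl ⟨hc, hv⟩⟩

theorem expl_open {S Z : Set Site} {ω : Config} {v : Site} (h : v ∈ expl S Z ω)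
    (h' : v ∉ clu S Z ω) : ω v = true := by
  by_contra hc
  rw [Bool.not_eq_true] at hc
  rcases h with ⟨hS, h | h | ⟨u, hu, huv⟩⟩
  · exact h' (clu_start h hS hc)
  · exact h' h
  · exact h' (clu_step hu huv hS hc)

theorem clu_conn {S Z : Set Site} {ω : Config} {v : Site} (h : v ∈ clu S Z ω) :
    ∃ z ∈ Z, Conn (clu S Z ω) z v := by
  obtain ⟨z, hz, h⟩ := h
  exact ⟨z, hz, h.cluster.mono (T := clu S Z ω) fun w hw => ⟨z, hz, hw⟩⟩

theorem clu_congr {S Z : Set Site} {ω ω' : Config} (h : ∀ v ∈ expl S Z ω, ω' v = ω v) :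
    clu S Z ω' = clu S Z ω := by
  ext v
  constructor
  · rintro ⟨z, hz, hv⟩
    have hzS := hv.1
    have h0 : ω z = false := by
      rw [← h z ⟨hzS.2, Or.inl hz⟩]; exact hzS.1
    refine hv.induct (clu_start hz hzS.2 h0) fun b c _ h2 h3 h4 => ?_
    refine clu_step h2 h3 h4.2 ?_
    rw [← h c ⟨h4.2, Or.inr (Or.inr ⟨b, h2, h3⟩)⟩]; exact h4.1
  · intro hv
    obtain ⟨z, hz, hv⟩ := clu_conn hv
    refine ⟨z, hz, hv.mono fun w hw => ?_⟩
    obtain ⟨h1, h2⟩ := clu_subset hw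
    refine ⟨?_, h1⟩
    have := h w ⟨h1, Or.inr (Or.inl hw)⟩
    exact this.trans h2

theorem expl_congr {S Z : Set Site} {ω ω' : Config} (h : ∀ v ∈ expl S Z ω, ω' v = ω v) :
    expl S Z ω' = expl S Z ω := by
  unfold expl
  rw [clu_congr h]

/-- Reflection of the lattice exchanging the two slanted sides of `trap k (2 * j)`. -/
def refl (j : ℤ) : Site ≃ Site where
  toFun v := (2 * j - v.1 - v.2, v.2)
  invFun v := (2 * j - v.1 - v.2, v.2)
  left_inv v := by ext <;> simp; ring
  right_inv v := by ext <;> simp; ring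

theorem refl_fst (j : ℤ) (v : Site) : (refl j v).1 = 2 * j - v.1 - v.2 := rfl

theorem refl_snd (j : ℤ) (v : Site) : (refl j v).2 = v.2 := rfl

theorem refl_refl (j : ℤ) (v : Site) : refl j (refl j v) = v := (refl j).left_inv v

theorem adj_refl (j : ℤ) {u v : Site} (h : Adj u v) : Adj (refl j u) (refl j v) := by
  rw [adj_iff] at h ⊢
  simp only [refl_fst, refl_snd]
  omega

theorem refl_mem_trap {k j : ℤ} {v : Site} (h : v ∈ trap k (2 * j)) :
    refl j v ∈ trap k (2 * j) := by
  rw [mem_trap] at h ⊢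
  simp only [refl_fst, refl_snd]
  omega

/-- The left half of the trapezoid. -/
def halfTrap (k j : ℤ) : Set Site := {v | v ∈ trap k (2 * j) ∧ 2 * v.1 + v.2 < 2 * j}

/-- The closed cluster of the bottom row in the left half. -/
def leftClu (k j : ℤ) (η : Config) : Set Site := clu (halfTrap k j) {v | v.2 = 0} η

/-- The sites examined to find `leftClu`. -/
def leftExpl (k j : ℤ) (η : Config) : Set Site := expl (halfTrap k j) {v | v.2 = 0} η

/-- No closed crossing of the left half from bottom to top. -/
def noLeft (k j : ℤ) : Set Config := {η | ∀ v ∈ leftClu k j η, v.2 ≠ 2 * k}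

/-- An open walk from the left side to the right half of the top side. -/
def slant (k j : ℤ) : Set Config :=
  {η | ∃ s e, Conn (op η ∩ trap k (2 * j)) s e ∧ s.1 = 0 ∧ e.2 = 2 * k ∧ j - k ≤ e.1}

/-- The sites declared open after the examined sites have been opened, their mirror images
closed. -/
def fill (k j : ℤ) (η : Config) : Set Site :=
  {v | v ∈ leftExpl k j η ∨ (refl j v ∉ leftExpl k j η ∧ η v = true)}

theorem leftExpl_subset {k j : ℤ} {η : Config} {v : Site} (h : v ∈ leftExpl k j η) :
    v ∈ halfTrap k j := h.1

theorem refl_notMem_leftExpl {k j : ℤ} {η : Config} {v : Site} (h : v ∈ leftExpl k j η) :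
    refl j v ∉ leftExpl k j η := by
  intro h'
  have h1 := (leftExpl_subset h).2
  have h2 := (leftExpl_subset h').2
  simp only [refl_fst, refl_snd] at h2
  omega

theorem slant_of_fill {k j : ℤ} (hk : 0 ≤ k) (hkj : k ≤ j) {η : Config} (hη : η ∈ noLeft k j)
    (h : ∃ s e, Conn (fill k j η ∩ trap k (2 * j)) s e ∧ (s.1 = 0 ∨ s.2 = 0 ∧ s.1 < j + 1) ∧
      e.2 = 2 * k ∧ j - k ≤ e.1) : η ∈ slant k j := by
  obtain ⟨s, e, hse, hs, he, he'⟩ := h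
  rcases trap_hex (op η) (r := 0) hk hkj le_rfl (by omega) with ⟨s, e, h1, h2, h3⟩ | h
  · refine ⟨s, e, h1, ?_, h3⟩
    have := mem_trap.1 h1.1.2
    omega
  exfalso
  obtain ⟨t, u, htu, ht, ht', hu⟩ := h
  set C : Set Site := (fill k j η)ᶜ ∩ trap k (2 * j) with hC
  -- the mirror image of the cluster of a site leads to the lower right boundary
  have lead : ∀ v ∈ leftClu k j η, ∃ u, Conn C (refl j v) u ∧ u.2 = 0 ∧ j ≤ u.1 := by
    intro v hv
    obtain ⟨z, hz, hzv⟩ := clu_conn hv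
    have sub : ∀ w ∈ leftClu k j η, refl j w ∈ C := by
      intro w hw
      have hw' : w ∈ leftExpl k j η := ⟨(clu_subset hw).1, Or.inr (Or.inl hw)⟩
      refine ⟨?_, refl_mem_trap (clu_subset hw).1.1⟩
      rintro (h | ⟨h, -⟩)
      · exact refl_notMem_leftExpl hw' h
      · rw [refl_refl] at h; exact h hw'
    refine ⟨refl j z, (hzv.map (refl j) (fun a b h => adj_refl j h) sub).symm, hz, ?_⟩
    have h1 := (clu_subset hzv.1).1.2
    have hz : z.2 = 0 := hz
    rw [refl_fst]; omega
  have concl : ∃ t u, Conn C t u ∧ t.2 = 2 * k ∧ t.1 ≤ j - k ∧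
      (u.1 + u.2 = 2 * j ∨ u.2 = 0 ∧ j ≤ u.1) := by
    by_contra hno
    have notExpl : ∀ v, η v = false → v ∉ leftClu k j η → v ∉ leftExpl k j η := by
      intro v hv hv' h
      have := expl_open h hv'
      rw [hv] at this
      exact absurd this (by decide)
    have inC : ∀ v ∈ trap k (2 * j), η v = false → v ∉ leftClu k j η → v ∈ C := by
      intro v hD hv hv'
      refine ⟨?_, hD⟩
      rintro (h | ⟨-, h⟩)
      · exact notExpl v hv hv' h
      · rw [hv] at h; exact absurd h (by decide)
    have closed : ∀ v, v ∈ (op η)ᶜ → η v = false := by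
      intro v hv; simpa [op] using hv
    have key : u ∉ leftClu k j η ∧ Conn C t u := by
      refine htu.induct (p := fun u => u ∉ leftClu k j η ∧ Conn C t u) ?_ ?_
      · have : t ∉ leftClu k j η := fun h => hη t h ht
        exact ⟨this, Conn.refl (inC t htu.1.2 (closed _ htu.1.1) this)⟩
      · rintro b c hb ⟨hb1, hb2⟩ hbc hc
        have hc0 := closed _ hc.1
        have hb0 := closed _ hb.mem_right.1
        have hbD := hb.mem_right.2
        by_cases hcK : c ∈ leftClu k j η
        · exfalso
          obtain ⟨u', hu', hu2, hu3⟩ := lead c hcK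
          have hcL := (clu_subset hcK).1
          have hbL : ¬ (2 * b.1 + b.2 < 2 * j) := fun h =>
            hb1 (clu_step hcK (adj_symm hbc) ⟨hbD, h⟩ hb0)
          have hcL' := hcL.2
          have : b = refl j c ∨ Adj b (refl j c) := by
            rw [adj_iff] at hbc ⊢
            rw [Prod.ext_iff]
            simp only [refl_fst, refl_snd]
            omega
          rcases this with rfl | h
          · exact hno ⟨t, u', hb2.trans hu', ht, ht', Or.inr ⟨hu2, hu3⟩⟩
          · exact hno ⟨t, u', (hb2.step h hu'.1).trans hu', ht, ht', Or.inr ⟨hu2, hu3⟩⟩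
        · exact ⟨hcK, hb2.step hbc (inC c hc.2 hc0 hcK)⟩
    have huD := mem_trap.1 htu.mem_right.2
    refine hno ⟨t, u, key.2, ht, ht', ?_⟩
    rcases hu with hu | ⟨hu, -⟩
    · exact Or.inl hu
    · refine Or.inr ⟨hu, ?_⟩
      by_contra hlt
      exact key.1 (clu_start hu ⟨htu.mem_right.2, by omega⟩ (closed _ htu.mem_right.1))
  obtain ⟨t, u, htu, ht, ht', hu⟩ := concl
  obtain ⟨v, hv, hv'⟩ := trap_meet (fun v hv => hv.2) (fun v hv => hv.2) hse (by omega)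
    he he' htu ht ht' hu
  exact hv'.1 hv.1

open Classical in
/-- The mirrored and flipped configuration, unchanged on the examined sites and their images. -/
noncomputable def mirror (k j : ℤ) (η : Config) : Config := fun v =>
  if v ∈ trap k (2 * j) ∧ v ∉ leftExpl k j η ∧ refl j v ∉ leftExpl k j η then !η (refl j v)
  else η v

theorem leftExpl_mirror (k j : ℤ) (η : Config) :
    leftExpl k j (mirror k j η) = leftExpl k j η :=
  expl_congr fun _ hv => if_neg fun h => h.2.1 hv

theorem leftClu_mirror (k j : ℤ) (η : Config) :
    leftClu k j (mirror k j η) = leftClu k j η :=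
  clu_congr fun _ hv => if_neg fun h => h.2.1 hv

theorem mirror_mirror (k j : ℤ) (η : Config) : mirror k j (mirror k j η) = η := by
  funext v
  rw [mirror, leftExpl_mirror]
  by_cases h : v ∈ trap k (2 * j) ∧ v ∉ leftExpl k j η ∧ refl j v ∉ leftExpl k j η
  · have h' : refl j v ∈ trap k (2 * j) ∧ refl j v ∉ leftExpl k j η ∧
        refl j (refl j v) ∉ leftExpl k j η := by
      rw [refl_refl]; exact ⟨refl_mem_trap h.1, h.2.2, h.2.1⟩
    rw [if_pos h, mirror, if_pos h', refl_refl, Bool.not_not]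
  · rw [if_neg h, mirror, if_neg h]

theorem refl_mem_fill {k j : ℤ} {η : Config} {v : Site} (hv : v ∈ trap k (2 * j))
    (h : v ∉ fill k j η) : refl j v ∈ fill k j (mirror k j η) := by
  unfold fill at h ⊢
  simp only [Set.mem_ofPred_eq, not_or, not_and, leftExpl_mirror, refl_refl] at h ⊢
  by_cases h1 : refl j v ∈ leftExpl k j η
  · exact Or.inl h1
  · refine Or.inr ⟨h.1, ?_⟩
    have h' : refl j v ∈ trap k (2 * j) ∧ refl j v ∉ leftExpl k j η ∧
        refl j (refl j v) ∉ leftExpl k j η := by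
      rw [refl_refl]; exact ⟨refl_mem_trap hv, h1, h.1⟩
    have := h.2 h1
    rw [mirror, if_pos h', refl_refl]
    simpa using this

theorem noLeft_subset {k j : ℤ} (hk : 0 ≤ k) (hkj : k ≤ j) {η : Config} (hη : η ∈ noLeft k j) :
    η ∈ slant k j ∨ mirror k j η ∈ slant k j := by
  rcases trap_hex (fill k j η) (r := j + 1) hk hkj (by omega) le_rfl with h | h
  · exact Or.inl (slant_of_fill hk hkj hη h)
  · right
    obtain ⟨s, e, hse, hs, hs', he⟩ := h
    refine slant_of_fill hk hkj ?_ ⟨refl j e, refl j s, (hse.map (refl j)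
      (fun a b h => adj_refl j h) (T := fill k j (mirror k j η) ∩ trap k (2 * j))
      fun v hv => ⟨refl_mem_fill hv.2 hv.1, refl_mem_trap hv.2⟩).symm, ?_, hs, ?_⟩
    · intro v hv
      rw [leftClu_mirror] at hv
      exact hη v hv
    · rw [refl_fst, refl_snd]; omega
    · rw [refl_fst]; omega

theorem op_inter_congr {S : Set Site} {ω ω' : Config} (h : ∀ v ∈ S, ω v = ω' v) :
    op ω ∩ S = op ω' ∩ S := by
  ext v
  simp only [op, Set.mem_inter_iff, Set.mem_ofPred_eq]
  exact and_congr_left fun hv => by rw [h v hv]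

theorem isLoc_conn {S : Set Site} {a b c d : ℤ} (hS : S ⊆ rect a b c d) (R : Site → Site → Prop) :
    IsLoc {ω | ∃ s e, Conn (op ω ∩ S) s e ∧ R s e} := by
  refine isLoc_of_rect a b c d fun ω ω' h ⟨s, e, hse, hR⟩ => ⟨s, e, ?_, hR⟩
  rwa [← op_inter_congr fun v hv => h v (hS hv)]

theorem inc_conn (S : Set Site) (R : Site → Site → Prop) :
    Inc {ω | ∃ s e, Conn (op ω ∩ S) s e ∧ R s e} :=
  fun _ _ h ⟨s, e, hse, hR⟩ => ⟨s, e, hse.mono (Set.inter_subset_inter_left _ h), hR⟩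

theorem isLoc_hc (a b c d : ℤ) : IsLoc {ω | HC (op ω) a b c d} :=
  isLoc_conn (S := rect a b c d) subset_rfl fun s e => s.1 = a ∧ e.1 = b

theorem inc_hc (a b c d : ℤ) : Inc {ω | HC (op ω) a b c d} :=
  inc_conn (rect a b c d) fun s e => s.1 = a ∧ e.1 = b

theorem isLoc_vc (a b c d : ℤ) : IsLoc {ω | VC (op ω) a b c d} :=
  isLoc_conn (S := rect a b c d) subset_rfl fun s e => s.2 = c ∧ e.2 = d

theorem inc_vc (a b c d : ℤ) : Inc {ω | VC (op ω) a b c d} :=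
  inc_conn (rect a b c d) fun s e => s.2 = c ∧ e.2 = d

theorem IsLoc.comp {E : Set Config} (h : IsLoc E) (σ : Site ≃ Site) (b : Bool) :
    IsLoc {ω | (fun v => xor b (ω (σ v))) ∈ E} := by
  obtain ⟨Λ, h⟩ := h
  refine ⟨Λ.map σ.toEmbedding, fun ω ω' hω => h _ _ fun v hv => ?_⟩
  rw [hω (σ v) (by simpa using hv)]

theorem op_comp (ω : Config) (σ : Site ≃ Site) :
    op (fun v => xor false (ω (σ v))) = σ ⁻¹' op ω := by
  ext v; simp [op]

theorem Inc.comp {E : Set Config} (h : Inc E) (σ : Site ≃ Site) :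
    Inc {ω | (fun v => xor false (ω (σ v))) ∈ E} := by
  refine fun ω ω' hω => h _ _ ?_
  rw [op_comp, op_comp]
  exact Set.preimage_mono hω

theorem trap_subset (k M : ℤ) : trap k M ⊆ rect 0 M 0 (2 * k) := by
  intro v hv
  have := mem_trap.1 hv
  rw [mem_rect]; omega

theorem leftExpl_congr {k j : ℤ} {ω ω' : Config} (h : ∀ v ∈ trap k (2 * j), ω' v = ω v) :
    leftExpl k j ω' = leftExpl k j ω :=
  expl_congr fun v hv => h v (leftExpl_subset hv).1

theorem leftClu_congr {k j : ℤ} {ω ω' : Config} (h : ∀ v ∈ trap k (2 * j), ω' v = ω v) :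
    leftClu k j ω' = leftClu k j ω :=
  clu_congr fun v hv => h v (leftExpl_subset hv).1

theorem mirror_congr {k j : ℤ} {ω ω' : Config} (h : ∀ v ∈ trap k (2 * j), ω' v = ω v) {v : Site}
    (hv : ω' v = ω v) : mirror k j ω' v = mirror k j ω v := by
  rw [mirror, mirror, leftExpl_congr h]
  split_ifs with h1
  · rw [h _ (refl_mem_trap h1.1)]
  · exact hv

theorem isLoc_slant (k j : ℤ) : IsLoc (slant k j) :=
  isLoc_conn (trap_subset k (2 * j)) fun s e => s.1 = 0 ∧ e.2 = 2 * k ∧ j - k ≤ e.1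

theorem inc_slant (k j : ℤ) : Inc (slant k j) :=
  inc_conn (trap k (2 * j)) fun s e => s.1 = 0 ∧ e.2 = 2 * k ∧ j - k ≤ e.1

theorem measure_noLeft_le {μ : Measure Config} (hμ : IsBernoulliHalf μ) {k j : ℤ} (hk : 0 ≤ k)
    (hkj : k ≤ j) : μ (noLeft k j) ≤ 2 * μ (slant k j) := by
  set Λ : Finset Site := Finset.Icc 0 (2 * j) ×ˢ Finset.Icc 0 (2 * k) with hΛ
  have sub : ∀ v ∈ trap k (2 * j), v ∈ Λ := by
    intro v hv
    have := mem_rect.1 (trap_subset _ _ hv)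
    simp only [hΛ, Finset.mem_product, Finset.mem_Icc]
    omega
  have l1 : LocOn Λ (slant k j) := by
    rintro ω ω' h ⟨s, e, hse, hR⟩
    refine ⟨s, e, ?_, hR⟩
    rwa [← op_inter_congr fun v hv => h v (sub v hv)]
  have l2 : LocOn Λ (noLeft k j ∩ {η | mirror k j η ∈ slant k j}) := by
    rintro ω ω' h ⟨h1, h2⟩
    have h' : ∀ v ∈ trap k (2 * j), ω' v = ω v := fun v hv => (h v (sub v hv)).symm
    refine ⟨fun v hv => h1 v ?_, l1 _ _ (fun v hv => ?_) h2⟩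
    · rwa [leftClu_congr h'] at hv
    · exact (mirror_congr h' (h v hv).symm).symm
  have h2 : μ (noLeft k j ∩ {η | mirror k j η ∈ slant k j}) ≤ μ (slant k j) := by
    refine measure_le_of_inj hμ l2 l1 (mirror k j) (fun ω h => h.2) fun ω ω' h v hv => ?_
    rw [← mirror_mirror k j ω, ← mirror_mirror k j ω']
    exact mirror_congr (fun w hw => h w (sub w hw)) (h v hv)
  calc μ (noLeft k j)
      ≤ μ (slant k j ∪ (noLeft k j ∩ {η | mirror k j η ∈ slant k j})) := by
        refine measure_mono fun η hη => ?_
        rcases noLeft_subset hk hkj hη with h | h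
        · exact Or.inl h
        · exact Or.inr ⟨hη, h⟩
    _ ≤ _ := measure_union_le _ _
    _ ≤ _ := by rw [two_mul]; gcongr

/-- An open walk between the slanted sides of the trapezoid. -/
def across (k M : ℤ) : Set Config :=
  {η | ∃ s e, Conn (op η ∩ trap k M) s e ∧ s.1 = 0 ∧ e.1 + e.2 = M}

theorem measure_slant_sq_le {μ : Measure Config} (hμ : IsBernoulliHalf μ) {k j : ℤ} :
    μ (slant k j) * μ (slant k j) ≤ μ (across k (2 * j)) := by
  have h1 := IsBernoulliHalf.measure_comp hμ (refl j) false (isLoc_slant k j)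
  have h2 := harris hμ (isLoc_slant k j) ((isLoc_slant k j).comp (refl j) false)
    (inc_slant k j) ((inc_slant k j).comp (refl j))
  rw [h1] at h2
  refine h2.trans (measure_mono ?_)
  rintro ω ⟨⟨s, e, hse, hs, he, he'⟩, s', e', hse', hs', he'', he'''⟩
  have h3 : Conn (op ω ∩ trap k (2 * j)) (refl j e') (refl j s') := by
    rw [op_comp] at hse'
    exact (hse'.map (T := op ω ∩ trap k (2 * j)) (refl j) (fun a b h => adj_refl j h)
      fun v hv => ⟨hv.1, refl_mem_trap hv.2⟩).symm
  obtain ⟨v, hv, hv'⟩ := trap_meet (fun v hv => hv.mem_right.2)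
    (fun v hv => hv.mem_right.2) hse.cluster (Or.inl hs) he he' h3.cluster he''
    (by rw [refl_fst]; omega) (Or.inl (by rw [refl_fst, refl_snd]; omega))
  have hv : Conn _ s v := hv
  have hv' : Conn _ (refl j e') v := hv'
  exact ⟨s, refl j s', (hv.trans hv'.symm).trans h3, hs, by rw [refl_fst, refl_snd]; omega⟩

theorem noLeft_of_blocked {k j b : ℤ} {η : Config}
    (hb : ∀ v ∈ halfTrap k j, v.1 ≤ b) {P : Set Site}
    (hP : ∀ v ∈ P, 0 ≤ v.2 ∧ v.2 ≤ 2 * k ∧ (v ∈ op η ∨ v ∉ halfTrap k j)) {s e : Site}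
    (h : Conn P s e) (hs : s.1 < 0) (he : b < e.1) : η ∈ noLeft k j := by
  intro v hv hv2
  obtain ⟨z, hz, hzv⟩ := clu_conn hv
  have hz : z.2 = 0 := hz
  have hvc : VC (leftClu k j η) 0 b 0 (2 * k) := by
    refine VC.of_conn ?_ hzv hz.le hv2.ge fun w hw => ⟨?_, hb w (clu_subset hw).1⟩
    · have := mem_trap.1 (clu_subset hv).1.1
      omega
    · exact (mem_trap.1 (clu_subset hw).1.1).2.2.1
  obtain ⟨w, -, hw, hwP⟩ := hvc.blocks (fun v hv => ⟨(hP v hv).1, (hP v hv).2.1⟩) h hs he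
  rcases (hP w hwP).2.2 with h | h
  · have h' := (clu_subset hw).2
    have : η w = true := h
    rw [h'] at this
    exact absurd this (by decide)
  · exact h (clu_subset hw).1

theorem across_subset_noLeft {k j : ℤ} :
    across k (j + k) ⊆ noLeft k j := by
  rintro η ⟨s, e, hse, hs, he⟩
  have hsD := mem_trap.1 hse.1.2
  have heD := mem_trap.1 hse.mem_right.2
  set P : Set Site := (op η ∩ trap k (j + k)) ∪ ({(-1, s.2)} ∪ {v | v.2 = e.2 ∧ e.1 < v.1}) with hP
  have h1 : Conn P (-1, s.2) (j + k + 1, e.2) := by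
    refine (((Conn.refl (Or.inr (Or.inl rfl))).step ?_ (Or.inl hse.1)).trans
      (hse.mono Set.subset_union_left)).trans
      (((Conn.refl (Or.inl hse.mem_right)).step (c := (e.1 + 1, e.2)) ?_ (Or.inr (Or.inr ?_))).trans
        (Conn.row (by omega) fun t h1 h2 => Or.inr (Or.inr ?_)))
    · rw [adj_iff]; grind
    · rw [adj_iff]; grind
    · exact ⟨rfl, by simp⟩
    · exact ⟨rfl, by simp only; omega⟩
  refine noLeft_of_blocked (b := j + k) (fun v hv => ?_) (fun v hv => ?_) h1
    (by simp) (by simp)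
  · have h2 := mem_trap.1 hv.1
    have := hv.2
    omega
  · rcases hv with hv | hv | hv
    · have := mem_trap.1 hv.2
      exact ⟨this.1, this.2.1, Or.inl hv.1⟩
    · obtain rfl : v = _ := hv
      refine ⟨hsD.1, hsD.2.1, Or.inr fun h => ?_⟩
      have := mem_trap.1 h.1
      simp only at this
      omega
    · obtain ⟨hv1, hv2⟩ := hv
      refine ⟨by omega, by omega, Or.inr fun h => ?_⟩
      have h2 := mem_trap.1 h.1
      have := h.2
      omega

theorem hc_subset_noLeft {k : ℤ} :
    {η | HC (op η) 0 (2 * k) 0 (2 * k)} ⊆ noLeft k (2 * k) := by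
  intro η h
  obtain ⟨P, s, e, hse, hs, he, hP⟩ := HC.extend h
  refine noLeft_of_blocked (b := 2 * k) (fun v hv => ?_) (fun v hv => ?_) hse hs he
  · have h2 := mem_trap.1 hv.1
    have := hv.2
    omega
  · obtain ⟨h1, h2, h3⟩ := hP v hv
    refine ⟨h1, h2, ?_⟩
    rcases h3 with h3 | h3
    · exact Or.inl h3.1
    · refine Or.inr fun h => ?_
      have h2 := mem_trap.1 h.1
      have := h.2
      omega

theorem op_comp_swap (ω : Config) : op (fun v => xor true (ω (Equiv.prodComm ℤ ℤ v))) =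
    Prod.swap ⁻¹' (op ω)ᶜ := by
  ext v; simp [op]

theorem half_le_measure_noLeft {μ : Measure Config} (hμ : IsBernoulliHalf μ) {k : ℤ}
    (hk : 0 ≤ k) : 1 / 2 ≤ μ (noLeft k (2 * k)) := by
  have := hμ.1
  have h1 := IsBernoulliHalf.measure_comp hμ (Equiv.prodComm ℤ ℤ) true
    (isLoc_hc 0 (2 * k) 0 (2 * k))
  have h2 : (1 : ℝ≥0∞) ≤ 2 * μ {η | HC (op η) 0 (2 * k) 0 (2 * k)} := by
    calc (1 : ℝ≥0∞) = μ Set.univ := measure_univ.symm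
      _ ≤ μ ({η | HC (op η) 0 (2 * k) 0 (2 * k)} ∪ {ω | (fun v => xor true
            (ω (Equiv.prodComm ℤ ℤ v))) ∈ {η | HC (op η) 0 (2 * k) 0 (2 * k)}}) := by
          refine measure_mono fun ω _ => ?_
          rcases hex (op ω) (a := 0) (b := 2 * k) (c := 0) (d := 2 * k) (by omega) (by omega)
            with h | h
          · exact Or.inl h
          · right
            rw [Set.mem_ofPred_eq, Set.mem_ofPred_eq, op_comp_swap]
            exact hc_swap.2 h
      _ ≤ _ := measure_union_le _ _
      _ = _ := by rw [h1]; exact (two_mul _).symm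
  calc (1 : ℝ≥0∞) / 2 ≤ μ {η | HC (op η) 0 (2 * k) 0 (2 * k)} := by
        rw [ENNReal.div_le_iff' two_ne_zero ENNReal.ofNat_ne_top]; exact h2
    _ ≤ _ := measure_mono hc_subset_noLeft

theorem across_bound {μ : Measure Config} (hμ : IsBernoulliHalf μ) {k j : ℤ} (hk : 0 ≤ k)
    (hkj : k ≤ j) {c : ℝ≥0∞} (hc : c ≤ μ (noLeft k j)) :
    c / 2 * (c / 2) ≤ μ (across k (2 * j)) := by
  have : c / 2 ≤ μ (slant k j) := by
    rw [ENNReal.div_le_iff' two_ne_zero ENNReal.ofNat_ne_top]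
    exact hc.trans (measure_noLeft_le hμ hk hkj)
  exact (mul_le_mul' this this).trans (measure_slant_sq_le hμ)

theorem exists_across_bound (i : ℕ) : ∃ c : ℝ≥0∞, c ≠ 0 ∧ ∀ μ : Measure Config,
    IsBernoulliHalf μ → ∀ k : ℤ, 0 ≤ k → c ≤ μ (across k ((2 ^ (i + 1) + 2) * k)) := by
  induction i with
  | zero =>
    refine ⟨1 / 2 / 2 * (1 / 2 / 2), by simp [ENNReal.div_eq_zero_iff], fun μ hμ k hk => ?_⟩
    have := across_bound hμ hk (j := 2 * k) (by omega) (half_le_measure_noLeft hμ hk)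
    convert this using 3
    ring
  | succ i ih =>
    obtain ⟨c, hc0, hc⟩ := ih
    refine ⟨c / 2 * (c / 2), by simp [ENNReal.div_eq_zero_iff, hc0], fun μ hμ k hk => ?_⟩
    have hkj : k ≤ (2 ^ (i + 1) + 1) * k := by
      nlinarith [pow_pos (show (0:ℤ) < 2 by norm_num) (i + 1)]
    have h := (hc μ hμ k hk).trans (measure_mono (μ := μ)
      (t := noLeft k ((2 ^ (i + 1) + 1) * k)) (by
      have := across_subset_noLeft (k := k) (j := (2 ^ (i + 1) + 1) * k)
      convert this using 2
      ring))
    have := across_bound hμ hk hkj h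
    convert this using 3
    ring

/-- Translation of the lattice. -/
def shift (a : Site) : Site ≃ Site := Equiv.addLeft a

theorem adj_shift (a : Site) {u v : Site} (h : Adj u v) : Adj (shift a u) (shift a v) := by
  rw [adj_iff] at h ⊢
  simp only [shift, Equiv.coe_addLeft, Prod.fst_add, Prod.snd_add]
  omega

theorem hc_shift {O : Set Site} (t : Site) {a b c d : ℤ} (h : HC (shift t ⁻¹' O) a b c d) :
    HC O (t.1 + a) (t.1 + b) (t.2 + c) (t.2 + d) := by
  obtain ⟨s, e, hse, hs, he⟩ := h
  refine ⟨shift t s, shift t e, hse.map (shift t) (fun a b h => adj_shift t h) ?_, ?_, ?_⟩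
  · intro v hv
    refine ⟨hv.1, ?_⟩
    have := mem_rect.1 hv.2
    rw [mem_rect]
    simp only [shift, Equiv.coe_addLeft, Prod.fst_add, Prod.snd_add]
    omega
  · simp [shift, hs]
  · simp [shift, he]

/-- Russo-Seymour-Welsh theory: crossing probabilities of rectangles of bounded aspect ratio
are bounded below. -/
theorem rsw (ρ : ℕ) : ∃ c : ℝ≥0∞, c ≠ 0 ∧ ∀ μ : Measure Config, IsBernoulliHalf μ →
    ∀ x₀ x₁ y₀ y₁ : ℤ, x₀ ≤ x₁ → y₀ ≤ y₁ → x₁ - x₀ ≤ ρ * (y₁ - y₀ + 1) →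
      c ≤ μ {ω | HC (op ω) x₀ x₁ y₀ y₁} := by
  obtain ⟨c, hc0, hc⟩ := exists_across_bound (4 * ρ)
  refine ⟨min c ((1 / 2) ^ (2 * ρ + 1)), ?_, fun μ hμ x₀ x₁ y₀ y₁ hx hy hxy => ?_⟩
  · have : ((1 : ℝ≥0∞) / 2) ^ (2 * ρ + 1) ≠ 0 := pow_ne_zero _ (by simp)
    rcases min_choice c ((1 / 2) ^ (2 * ρ + 1)) with h | h <;> rw [h] <;> assumption
  by_cases hh : y₁ ≤ y₀ + 1
  · refine (min_le_right _ _).trans ?_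
    have hw : x₁ - x₀ ≤ 2 * ρ := by nlinarith
    have := hμ.2 (Finset.Icc x₀ x₁ ×ˢ {y₀}) (fun _ => true)
    refine le_trans ?_ (measure_mono (μ := μ)
      (s := {ω | ∀ v ∈ Finset.Icc x₀ x₁ ×ˢ {y₀}, ω v = true}) ?_)
    · rw [this]
      refine pow_le_pow_right_of_le_one' (by simp) ?_
      simp only [Finset.card_product, Int.card_Icc, Finset.card_singleton]
      omega
    · intro ω hω
      refine ⟨(x₀, y₀), (x₁, y₀), Conn.row hx fun t h1 h2 => ⟨hω _ (by simp [h1, h2]), ?_⟩,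
        rfl, rfl⟩
      rw [mem_rect]; simp only; omega
  · refine (min_le_left _ _).trans ?_
    set k := (y₁ - y₀) / 2 with hk
    have hk1 : 1 ≤ k := by omega
    have hw : x₁ - x₀ ≤ 2 ^ (4 * ρ + 1) * k := by
      have h1 : ((4 * ρ : ℕ) : ℤ) ≤ 2 ^ (4 * ρ + 1) := by
        have : 4 * ρ < 2 ^ (4 * ρ + 1) := (Nat.lt_two_pow_self).trans
          (Nat.pow_lt_pow_right (by norm_num) (by omega))
        exact_mod_cast this.le
      have h2 : y₁ - y₀ + 1 ≤ 4 * k := by omega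
      have h3 : (ρ : ℤ) * (y₁ - y₀ + 1) ≤ ρ * (4 * k) := by gcongr
      have h4 : ((4 * ρ : ℕ) : ℤ) * k ≤ 2 ^ (4 * ρ + 1) * k := by gcongr
      push_cast at h4
      linarith
    have h1 := IsBernoulliHalf.measure_comp hμ (shift (x₀, y₀)) false
      (E := across k ((2 ^ (4 * ρ + 1) + 2) * k))
      (isLoc_conn (trap_subset _ _) fun s e => s.1 = 0 ∧ e.1 + e.2 = _)
    refine (hc μ hμ k (by omega)).trans (h1.symm.le.trans (measure_mono ?_))
    rintro ω ⟨s, e, hse, hs, he⟩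
    rw [op_comp] at hse
    have heD := mem_trap.1 hse.mem_right.2
    have h2 : HC (shift (x₀, y₀) ⁻¹' op ω) 0 (x₁ - x₀) 0 (y₁ - y₀) := by
      refine (HC.of_conn (by omega) hse hs.le (by linarith) fun v hv => ?_).mono ?_
      · have := mem_trap.1 hv.2; omega
      · exact fun v hv => hv.1.1
    have := hc_shift (x₀, y₀) h2
    simpa using this

theorem op_comp_prodComm (ω : Config) : op (fun v => xor false (ω (Equiv.prodComm ℤ ℤ v))) =
    Prod.swap ⁻¹' op ω := by
  ext v; simp [op]

theorem op_comp_not (ω : Config) : op (fun v => xor true (ω (Equiv.refl Site v))) = cl ω := by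
  ext v; simp [op, cl]

/-- Lower bounds for the crossing probabilities of rectangles, in both directions and for both
states. -/
theorem crossing_bounds (ρ : ℕ) : ∃ c : ℝ≥0∞, c ≠ 0 ∧ ∀ μ : Measure Config, IsBernoulliHalf μ →
    ∀ x₀ x₁ y₀ y₁ : ℤ, x₀ ≤ x₁ → y₀ ≤ y₁ →
      (x₁ - x₀ ≤ ρ * (y₁ - y₀ + 1) → c ≤ μ {ω | HC (op ω) x₀ x₁ y₀ y₁}) ∧
      (y₁ - y₀ ≤ ρ * (x₁ - x₀ + 1) → c ≤ μ {ω | VC (op ω) x₀ x₁ y₀ y₁}) ∧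
      (y₁ - y₀ ≤ ρ * (x₁ - x₀ + 1) → c ≤ μ {ω | VC (cl ω) x₀ x₁ y₀ y₁}) := by
  obtain ⟨c, hc0, hc⟩ := rsw ρ
  refine ⟨c, hc0, fun μ hμ x₀ x₁ y₀ y₁ hx hy => ?_⟩
  have hv : y₁ - y₀ ≤ ρ * (x₁ - x₀ + 1) → c ≤ μ {ω | VC (op ω) x₀ x₁ y₀ y₁} := fun h => by
    refine (hc μ hμ y₀ y₁ x₀ x₁ hy hx h).trans ?_
    rw [← IsBernoulliHalf.measure_comp hμ (Equiv.prodComm ℤ ℤ) false (isLoc_hc y₀ y₁ x₀ x₁)]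
    refine measure_mono fun ω hω => ?_
    rw [Set.mem_ofPred_eq, Set.mem_ofPred_eq, op_comp_prodComm] at hω
    exact hc_swap.1 hω
  refine ⟨hc μ hμ x₀ x₁ y₀ y₁ hx hy, hv, fun h => (hv h).trans ?_⟩
  rw [← IsBernoulliHalf.measure_comp hμ (Equiv.refl Site) true (isLoc_vc x₀ x₁ y₀ y₁)]
  refine measure_mono fun ω hω => ?_
  rw [Set.mem_ofPred_eq, Set.mem_ofPred_eq, op_comp_not] at hω
  exact hω

theorem Conn.of_isChain {S : Set Site} : ∀ {p : List Site}, p.IsChain Adj → (∀ v ∈ p, v ∈ S) →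
    ∀ {a b : Site}, p.head? = some a → p.getLast? = some b → Conn S a b
  | [], _, _, _, _, h, _ => by simp at h
  | [x], _, hS, a, b, h, h' => by
    simp only [List.head?_cons, List.getLast?_singleton, Option.some.injEq] at h h'
    subst h; subst h'
    exact Conn.refl (hS _ (by simp))
  | x :: y :: l, hc, hS, a, b, h, h' => by
    rw [List.isChain_cons_cons] at hc
    simp only [List.head?_cons, Option.some.injEq] at h
    subst h
    have h1 : Conn S y b := Conn.of_isChain hc.2 (fun v hv => hS v (List.mem_cons_of_mem _ hv))
      rfl (by rwa [List.getLast?_cons_cons] at h')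
    exact ((Conn.refl (hS x (by simp))).step hc.1 h1.1).trans h1

/-- A walk contains a path with the same end points. -/
theorem Conn.exists_path {S : Set Site} {a b : Site} (h : Conn S a b) :
    ∃ p, PathIn S p ∧ p.head? = some a ∧ p.getLast? = some b := by
  refine h.induct
    ⟨[a], ⟨⟨by simp, by simp, List.isChain_singleton a⟩, by simpa using h.1⟩, rfl, rfl⟩ ?_
  rintro b c - ⟨p, ⟨⟨h1, h2, h3⟩, h4⟩, h5, h6⟩ hbc hc
  by_cases hcp : c ∈ p
  · obtain ⟨l, r, rfl⟩ := List.append_of_mem hcp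
    have hp : (l ++ [c]) <+: (l ++ c :: r) := ⟨r, by simp⟩
    refine ⟨l ++ [c], ⟨⟨by simp, h2.sublist hp.sublist, List.IsChain.prefix h3 hp⟩,
      fun v hv => h4 v (hp.subset hv)⟩, ?_, by simp⟩
    cases l <;> simpa using h5
  · refine ⟨p ++ [c], ⟨⟨by simp, ?_, ?_⟩, ?_⟩, ?_, by simp⟩
    · refine List.nodup_append.2 ⟨h2, by simp, fun x hx y hy h => ?_⟩
      rw [List.mem_singleton] at hy
      exact hcp (hy ▸ h ▸ hx)
    · refine List.isChain_append.2 ⟨h3, by simp, fun x hx y hy => ?_⟩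
      rw [h6] at hx
      simp at hx hy
      subst hx; subst hy; exact hbc
    · intro v hv
      rcases List.mem_append.1 hv with hv | hv
      · exact h4 v hv
      · rw [List.mem_singleton.1 hv]; exact hc
    · rw [List.head?_append_of_ne_nil _ h1, h5]

theorem hc_of_crossing {a b c d : ℤ} {ω : Config} {p : List Site}
    (h : HorizCrossing a b c d ω p) : HC {v | v ∈ p} a b c d := by
  obtain ⟨⟨⟨-, -, h1⟩, h2⟩, -, ⟨s, hs, hs'⟩, ⟨e, he, he'⟩⟩ := h
  exact ⟨s, e, Conn.of_isChain (S := {v | v ∈ p} ∩ rect a b c d) h1 (fun v hv => ⟨hv, h2 v hv⟩)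
    hs' he', hs.2, he.2⟩

theorem HC.exists_path {O : Set Site} {a b c d : ℤ} {ω : Config} (h : HC O a b c d)
    (hO : O ⊆ op ω) : ∃ p, HorizCrossing a b c d ω p ∧ ∀ v ∈ p, v ∈ O := by
  obtain ⟨s, e, hse, hs, he⟩ := h
  obtain ⟨p, ⟨h1, h2⟩, h3, h4⟩ := hse.exists_path
  exact ⟨p, ⟨⟨h1, fun v hv => (h2 v hv).2⟩, fun v hv => hO (h2 v hv).1,
    ⟨s, ⟨hse.1.2, hs⟩, h3⟩, ⟨e, ⟨hse.mem_right.2, he⟩, h4⟩⟩, fun v hv => (h2 v hv).1⟩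

/-- The bottom of a rectangle is not joined to the top by a walk avoiding a horizontal crossing. -/
theorem HC.no_escape {P : Set Site} {a b c d : ℤ} (h : HC P a b c d) {z v : Site} (hz : z.2 = c)
    (hzv : Conn (rect a b c d \ P) z v) (hv : ∀ t, v.2 < t → t ≤ d → (v.1, t) ∉ P) : False := by
  have hvR := mem_rect.1 hzv.mem_right.1
  have h1 : Conn (rect a b c d \ P) v (v.1, d) := by
    refine Conn.col (x := v.1) (y := v.2) hvR.2.2.2 fun t h1 h2 => ⟨?_, ?_⟩
    · rw [mem_rect]; simp only; omega
    · rcases h1.eq_or_lt with h1 | h1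
      · rw [← h1]; exact hzv.mem_right.2
      · exact hv t h1 h2
  obtain ⟨u, -, hu, hu'⟩ := h.meets_VC (O' := Pᶜ)
    ⟨z, (v.1, d), Conn.mono (T := Pᶜ ∩ rect a b c d) (fun w hw => ⟨hw.2, hw.1⟩) (hzv.trans h1),
      hz, rfl⟩
  exact hu' hu

/-- The closed cluster of the bottom side of a rectangle has the unique highest site `w`. -/
def Peak (a b c d : ℤ) (w : Site) : Set Config :=
  {ω | w ∈ clu (rect a b c d) {v | v.2 = c} ω ∧
    ∀ u ∈ clu (rect a b c d) {v | v.2 = c} ω, u = w ∨ u.2 < w.2}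

theorem clu_avoids {S Z : Set Site} {ω : Config} {p : List Site} (hp : IsOpenOn ω p) :
    clu S Z ω ⊆ S \ {v | v ∈ p} := by
  intro v hv
  have h := clu_subset hv
  refine ⟨h.1, fun hvp => ?_⟩
  have := hp v hvp
  rw [h.2] at this
  exact absurd this (by decide)

theorem exists_lowest_of_peak {a b c d : ℤ} {w : Site} (ha : a < w.1) (hd : w.2 < d)
    {ω : Config} (h : ω ∈ Peak a b c d w) :
    ∃ p, IsLowestCrossing a b c d ω p ∧ HighestPair p (w.1 - 1, w.2 + 1) := by
  obtain ⟨hw, hmax⟩ := h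
  set K := clu (rect a b c d) {v | v.2 = c} ω with hK
  have hwR := mem_rect.1 (clu_subset hw).1
  set O : Set Site := {v | ω v = true ∧ (v.2 = c ∨ ∃ u ∈ K, Adj u v)} with hO
  have hHC : HC O a b c d := by
    refine (hex O (by omega) (by omega)).resolve_right ?_
    rintro ⟨s, e, hse, hs, he⟩
    have key : e ∈ K := by
      refine hse.induct ?_ fun x y _ hx hxy hy => ?_
      · refine clu_start hs hse.1.2 ?_
        by_contra hc
        exact hse.1.1 ⟨by simpa using hc, Or.inl hs⟩
      · refine clu_step hx hxy hy.2 ?_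
        by_contra hc
        exact hy.1 ⟨by simpa using hc, Or.inr ⟨x, hx, hxy⟩⟩
    rcases hmax e key with rfl | h <;> omega
  obtain ⟨p, hp, hpO⟩ := hHC.exists_path (ω := ω) fun v hv => hv.1
  have hlow : ∀ v ∈ p, v.2 ≤ w.2 + 1 ∧
      (v.2 = w.2 + 1 → v = (w.1 - 1, w.2 + 1) ∨ v = (w.1, w.2 + 1)) := by
    intro v hv
    rcases (hpO v hv).2 with h1 | ⟨u, hu, huv⟩
    · exact ⟨by omega, fun h => by omega⟩
    · rw [adj_iff] at huv
      rcases hmax u hu with rfl | h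
      · refine ⟨by omega, fun h => ?_⟩
        simp only [Prod.ext_iff]
        omega
      · exact ⟨by omega, fun h => by omega⟩
  have htop : ∀ x, Adj w (x, w.2 + 1) → a ≤ x → x ≤ b → (x, w.2 + 1) ∈ p := by
    intro x hx hxa hxb
    by_contra hxp
    obtain ⟨z, hz, hzw⟩ := clu_conn hw
    refine (hc_of_crossing hp).no_escape hz ((hzw.mono (clu_avoids hp.2.1)).step hx ⟨?_, hxp⟩) ?_
    · rw [mem_rect]; simp only; omega
    · intro t ht _ htp
      have := (hlow _ htp).1
      simp only at this ht
      omega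
  refine ⟨p, ⟨hp, fun q hq v hv => ?_⟩, htop _ ?_ (by omega) (by omega), ?_, fun v hv => ?_⟩
  · refine ⟨hp.1.2 v hv, or_iff_not_imp_left.2 fun hvq => ?_⟩
    rintro ⟨r, ⟨⟨-, -, hr⟩, hrS⟩, hr1, ⟨t, ht, hr2⟩⟩
    have h1 := Conn.of_isChain hr hrS hr1 hr2
    obtain ⟨z, hz, hzv⟩ : ∃ z, z.2 = c ∧ Conn (rect a b c d \ {w | w ∈ q}) z v := by
      rcases (hpO v hv).2 with h2 | ⟨u, hu, huv⟩
      · exact ⟨v, h2, Conn.refl h1.1⟩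
      · obtain ⟨z, hz, hzu⟩ := clu_conn hu
        exact ⟨z, hz, (hzu.mono (clu_avoids hq.2.1)).step huv h1.1⟩
    refine (hc_of_crossing hq).no_escape hz (hzv.trans h1) fun s h2 h3 => ?_
    have := ht.2
    omega
  · rw [adj_iff]; grind
  · have := htop w.1 (by rw [adj_iff]; grind) (by omega) (by omega)
    simpa using this
  · have := hlow v hv
    simpa using this

theorem peak_of_lowest {a b c d : ℤ} {y : Site} (ha : a < y.1) (hb : y.1 + 2 ≤ b) (hc : c < y.2)
    {ω : Config} {p : List Site} (hp : IsLowestCrossing a b c d ω p) (hy : HighestPair p y) :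
    ω ∈ Peak a b c d (y.1 + 1, y.2 - 1) := by
  obtain ⟨hp, hlow⟩ := hp
  obtain ⟨hyp, hyp', hmax⟩ := hy
  have hyR := mem_rect.1 (hp.1.2 y hyp)
  have hoff : ∀ v : Site, v.2 = y.2 → v ≠ y → v ≠ (y.1 + 1, y.2) → v ∉ p := fun v hv h1 h2 hvp =>
    ((hmax v hvp).2 hv).elim h1 h2
  have hside : ∀ u ∈ clu (rect a b c d) {v | v.2 = c} ω, ∀ x, Adj u (x, y.2) → a ≤ x → x ≤ b →
      x = y.1 ∨ x = y.1 + 1 := by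
    intro u hu x hx hxa hxb
    by_contra! hne
    obtain ⟨z, hz, hzu⟩ := clu_conn hu
    refine (hc_of_crossing hp).no_escape hz ((hzu.mono (clu_avoids hp.2.1)).step hx ⟨?_, ?_⟩) ?_
    · rw [mem_rect]; simp only; omega
    · exact hoff _ rfl (fun h => hne.1 (congrArg Prod.fst h)) fun h => hne.2 (congrArg Prod.fst h)
    · intro t ht _ htp
      have := (hmax _ htp).1
      simp only at this ht
      omega
  constructor
  · have h1 : VC {v | ω v = true ∧ v.2 < y.2}ᶜ a b c d := by
      refine (hex _ (by omega) (by omega)).resolve_left fun h => ?_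
      obtain ⟨q, hq, hqO⟩ := h.exists_path (ω := ω) fun v hv => hv.1
      have hqy : ∀ v : Site, y.2 ≤ v.2 → v ∉ q := fun v hv hvq => absurd (hqO v hvq).2 (by omega)
      rcases (hlow q hq y hyp).2 with h | h
      · exact hqy y le_rfl h
      · refine h ?_
        have : Conn (rect a b c d \ {w | w ∈ q}) y (y.1, d) := by
          refine Conn.col (x := y.1) (y := y.2) hyR.2.2.2 fun t h1 h2 => ⟨?_, hqy _ h1⟩
          rw [mem_rect]; simp only; omega
        obtain ⟨r, hr, hr1, hr2⟩ := this.exists_path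
        exact ⟨r, hr, hr1, ⟨(y.1, d), ⟨this.mem_right.1, rfl⟩, hr2⟩⟩
    obtain ⟨s, e, hse, hs, he⟩ := h1
    obtain ⟨u, v, hsu, huv, hv, hvY⟩ := hse.exists_exit (Y := {v | v.2 < y.2})
      (show s.2 < y.2 by omega) (show ¬ e.2 < y.2 by omega)
    have hu : u ∈ clu (rect a b c d) {v | v.2 = c} ω := by
      refine ⟨s, hs, Conn.mono (T := cl ω ∩ rect a b c d) (fun w hw => ⟨?_, hw.1.2⟩) hsu⟩
      by_contra hcl
      exact hw.1.1 ⟨by simpa [cl] using hcl, hw.2⟩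
    have huy : u.2 < y.2 := hsu.mem_right.2
    have hvy : ¬ v.2 < y.2 := hvY
    have huR := mem_rect.1 (clu_subset hu).1
    have hvR := mem_rect.1 hv.2
    rw [adj_iff] at huv
    have huw : u = (y.1 + 1, y.2 - 1) := by
      have h1 := hside u hu u.1 (by rw [adj_iff]; grind) (by omega) (by omega)
      by_cases h3 : u.1 = y.1
      · have h2 := hside u hu (u.1 - 1) (by rw [adj_iff]; grind) (by omega) (by omega)
        omega
      · ext <;> simp only <;> omega
    rwa [huw] at hu
  · intro u hu
    by_contra! ⟨hne, hle⟩
    simp only at hle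
    obtain ⟨z, hz, hzu⟩ := clu_conn hu
    have hzu := hzu.mono (clu_avoids hp.2.1)
    have huR := mem_rect.1 (clu_subset hu).1
    by_cases hu2 : y.2 ≤ u.2
    · refine (hc_of_crossing hp).no_escape hz hzu fun t ht _ htp => ?_
      have := (hmax _ htp).1
      simp only at this
      omega
    · have h1 := hside u hu u.1 (by rw [adj_iff]; grind) (by omega) (by omega)
      by_cases h3 : u.1 = y.1
      · have h2 := hside u hu (u.1 - 1) (by rw [adj_iff]; grind) (by omega) (by omega)
        omega
      · refine hne ?_
        ext <;> simp only <;> omega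

theorem isLoc_of_clu {S Z : Set Site} {a b c d : ℤ} (hS : S ⊆ rect a b c d)
    (p : Set Site → Set Site → Prop) :
    IsLoc {ω | p (clu S Z ω) (op ω ∩ rect a b c d)} := by
  refine isLoc_of_rect a b c d fun ω ω' h hω => ?_
  rw [Set.mem_ofPred_eq] at hω ⊢
  rwa [clu_congr (ω := ω) (ω' := ω') fun v hv => (h v (hS hv.1)).symm, ← op_inter_congr h]

theorem isLoc_peak (a b c d : ℤ) (w : Site) : IsLoc (Peak a b c d w) :=
  isLoc_of_clu (S := rect a b c d) (Z := {v | v.2 = c}) subset_rfl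
    fun K _ => w ∈ K ∧ ∀ u ∈ K, u = w ∨ u.2 < w.2

theorem clu_shift (S Z : Set Site) (ω : Config) (t : Site) :
    clu (shift t ⁻¹' S) (shift t ⁻¹' Z) (fun v => xor false (ω (shift t v))) =
      shift t ⁻¹' clu S Z ω := by
  have h1 : ∀ v, v ∈ cl (fun v => xor false (ω (shift t v))) ↔ shift t v ∈ cl ω := by
    intro v; simp [cl]
  ext v
  constructor
  · rintro ⟨z, hz, h⟩
    exact ⟨shift t z, hz, h.map (T := cl ω ∩ S) (shift t) (fun a b h => adj_shift t h)
      fun v hv => ⟨(h1 v).1 hv.1, hv.2⟩⟩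
  · rintro ⟨z, hz, h⟩
    have h2 : ∀ v, shift t (shift (-t) v) = v := fun v => by simp [shift]
    have h3 : ∀ v, shift (-t) (shift t v) = v := fun v => by simp [shift]
    have := h.map (T := cl (fun v => xor false (ω (shift t v))) ∩ shift t ⁻¹' S) (shift (-t))
      (fun a b h => adj_shift (-t) h) fun v hv => by
        refine ⟨(h1 _).2 ?_, ?_⟩
        · rw [h2]; exact hv.1
        · rw [Set.mem_preimage, h2]; exact hv.2
    rw [h3] at this
    exact ⟨shift (-t) z, by rwa [Set.mem_preimage, h2], this⟩

theorem measure_peak_shift {μ : Measure Config} (hμ : IsBernoulliHalf μ) (a b c d : ℤ)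
    (w t : Site) :
    μ (Peak (t.1 + a) (t.1 + b) (t.2 + c) (t.2 + d) (t + w)) = μ (Peak a b c d w) := by
  rw [← IsBernoulliHalf.measure_comp hμ (shift t) false (isLoc_peak a b c d w)]
  congr 1
  ext ω
  have h1 : shift t ⁻¹' rect (t.1 + a) (t.1 + b) (t.2 + c) (t.2 + d) = rect a b c d := by
    ext v
    rw [Set.mem_preimage, mem_rect, mem_rect]
    simp [shift]
  have h2 : shift t ⁻¹' {v : Site | v.2 = t.2 + c} = {v | v.2 = c} := by
    ext v; simp [shift]
  have h3 := clu_shift (rect (t.1 + a) (t.1 + b) (t.2 + c) (t.2 + d)) {v | v.2 = t.2 + c} ω t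
  rw [h1, h2] at h3
  rw [Set.mem_ofPred_eq, Peak, Peak, Set.mem_ofPred_eq, Set.mem_ofPred_eq, h3]
  refine and_congr Iff.rfl ⟨fun h u hu => ?_, fun h u hu => ?_⟩
  · rcases h _ hu with h | h
    · exact Or.inl ((shift t).injective h)
    · simp only [shift, Equiv.coe_addLeft, Prod.snd_add] at h
      exact Or.inr (by omega)
  · obtain ⟨u, rfl⟩ := (shift t).surjective u
    rcases h u hu with h | h
    · exact Or.inl (by rw [h]; rfl)
    · simp only [shift, Equiv.coe_addLeft, Prod.snd_add]
      exact Or.inr (by omega)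

/-- The bottom segment from which the closed cluster below is grown. -/
def base (n : ℤ) : Set Site := {v | v.2 = -(30 * n) ∧ -n ≤ v.1 ∧ v.1 ≤ n}

/-- The closed cluster of `base n` in a large box. -/
def tower (n : ℤ) (ω : Config) : Set Site :=
  clu (rect (-(30 * n)) (30 * n) (-(30 * n)) (30 * n)) (base n) ω

/-- A closed crossing surrounded by open ones. -/
def funnel (n : ℤ) : Set Config :=
  {ω | VC (cl ω) (-n) n (-(30 * n)) (-1)} ∩
    ({ω | VC (op ω) (n + 1) (3 * n) (-(30 * n)) (2 * n)} ∩
      ({ω | VC (op ω) (-(3 * n)) (-n - 1) (-(30 * n)) (2 * n)} ∩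
        {ω | HC (op ω) (-(3 * n)) (3 * n) 0 (2 * n)}))

theorem exists_mem_tower {n : ℤ} {ω : Config} (h : ω ∈ funnel n) :
    ∃ e ∈ tower n ω, e.2 = -1 := by
  obtain ⟨⟨s, e, hse, hs, he⟩, -⟩ := h
  have hs1 := mem_rect.1 hse.1.2
  refine ⟨e, ⟨s, ⟨hs, hs1.1, hs1.2.1⟩, ?_⟩, he⟩
  refine Conn.mono (T := cl ω ∩ _) (fun v hv => ⟨hv.1, ?_⟩) hse
  have := mem_rect.1 hv.2
  rw [mem_rect]; omega

theorem notMem_op_of_clu {S Z : Set Site} {ω : Config} {v : Site} (h : v ∈ clu S Z ω)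
    (h' : v ∈ op ω) : False := by
  have h1 := (clu_subset h).2
  have h2 : ω v = true := h'
  rw [h1] at h2
  exact absurd h2 (by decide)

theorem tower_bounded {n : ℤ} (hn : 1 ≤ n) {ω : Config} (h : ω ∈ funnel n) {v : Site}
    (hv : v ∈ tower n ω) : -(3 * n) ≤ v.1 ∧ v.1 ≤ 3 * n ∧ v.2 < 2 * n := by
  obtain ⟨-, hr, hl, ht⟩ := h
  by_contra hne
  obtain ⟨z, hz, hzv⟩ := clu_conn hv
  obtain ⟨hz2, hz1, hz1'⟩ := hz
  obtain ⟨u, x, hzu, hux, hx, hxY⟩ := hzv.exists_exit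
    (Y := {v | -(3 * n) ≤ v.1 ∧ v.1 ≤ 3 * n ∧ v.2 < 2 * n})
    (show _ ∧ _ ∧ _ by omega) hne
  have hx' : x ∈ tower n ω := hx
  have hxW := mem_rect.1 (clu_subset hx).1
  have huY := hzu.mem_right.2
  simp only [Set.mem_ofPred_eq] at huY hxY
  set Q : Set Site := (tower n ω ∩ {v | -(3 * n) ≤ v.1 ∧ v.1 ≤ 3 * n ∧ v.2 < 2 * n}) ∪ {x} with hQ
  have hQK : ∀ v ∈ Q, v ∈ tower n ω := by
    rintro v (hv | rfl)
    · exact hv.1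
    · exact hx
  have hzx : Conn Q z x := (hzu.mono Set.subset_union_left).step hux (Or.inr rfl)
  have hQ2 : ∀ v ∈ Q, -(30 * n) ≤ v.2 ∧ v.2 ≤ 2 * n := by
    rintro v (hv | rfl)
    · have h1 := mem_rect.1 (clu_subset hv.1).1
      have h2 := hv.2
      simp only [Set.mem_ofPred_eq] at h2
      omega
    · rw [adj_iff] at hux
      omega
  by_cases h1 : 3 * n < x.1
  · obtain ⟨v, -, hv1, hv2⟩ := hr.blocks hQ2 hzx (by omega) h1
    exact notMem_op_of_clu (hQK v hv2) hv1
  by_cases h2 : x.1 < -(3 * n)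
  · obtain ⟨v, -, hv1, hv2⟩ := hl.blocks hQ2 hzx.symm h2 (by omega)
    exact notMem_op_of_clu (hQK v hv2) hv1
  · have hQ1 : ∀ v ∈ Q, -(3 * n) ≤ v.1 ∧ v.1 ≤ 3 * n := by
      rintro v (hv | rfl)
      · exact ⟨hv.2.1, hv.2.2.1⟩
      · omega
    obtain ⟨v, -, hv1, hv2⟩ := ht.blocks hQ1 hzx.symm (by omega) (by omega)
    exact notMem_op_of_clu (hQK v hv2) hv1

/-- A horizontal strip is crossed by open sites and sites of `tower n ω`. -/
def Strip (n : ℤ) (K O : Set Site) : Prop :=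
  HC (O ∪ K) (-(30 * n)) (30 * n) (-(6 * n) + 2) (-2)

/-- The tower is narrow and reaches high. -/
def Tall (n : ℤ) (K : Set Site) : Prop :=
  (∃ e ∈ K, e.2 = -1) ∧ ∀ v ∈ K, -(3 * n) ≤ v.1 ∧ v.1 ≤ 3 * n ∧ v.2 < 2 * n

/-- The site `v` lies just above a highest site of the tower. -/
def Cap (n : ℤ) (v : Site) (K : Set Site) : Prop :=
  (v.1, v.2 - 1) ∈ K ∧ ∀ u ∈ K, -(3 * n) ≤ u.1 ∧ u.1 ≤ 3 * n ∧ u.2 < v.2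

theorem exists_cap {n : ℤ} {ω : Config} (h : Tall n (tower n ω)) :
    ∃ v ∈ Finset.Icc (-(3 * n)) (3 * n) ×ˢ Finset.Icc 0 (2 * n), Cap n v (tower n ω) := by
  obtain ⟨⟨e, he, he'⟩, h⟩ := h
  have hfin : (tower n ω).Finite := by
    refine Set.Finite.subset (Finset.finite_toSet (Finset.Icc (-(30 * n)) (30 * n) ×ˢ
      Finset.Icc (-(30 * n)) (30 * n))) fun v hv => ?_
    have := mem_rect.1 (clu_subset hv).1
    simp only [Finset.coe_product, Finset.coe_Icc, Set.mem_prod, Set.mem_Icc]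
    omega
  obtain ⟨u, hu, hmax⟩ := hfin.exists_maximalFor (fun v : Site => v.2) _ ⟨e, he⟩
  have hle : ∀ v ∈ tower n ω, v.2 ≤ u.2 := fun v hv => by
    by_contra! hlt
    exact absurd (hmax hv hlt.le) (by simpa using hlt)
  have h1 := h u hu
  have h2 := hle e he
  refine ⟨(u.1, u.2 + 1), ?_, ?_, fun v hv => ?_⟩
  · simp only [Finset.mem_product, Finset.mem_Icc]
    omega
  · simpa using hu
  · have h3 := h v hv
    have h4 := hle v hv
    simp only
    omega

/-- The four sites around the place where a peak is created. -/
def tip (v : Site) : Finset Site :=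
  {v, (v.1 + 1, v.2), (v.1, v.2 + 1), (v.1 - 1, v.2 + 1)}

theorem eq_or_adj_of_notMem_tip {v c : Site} (h : Adj v c) (hc : c ∉ tip v) :
    c = (v.1, v.2 - 1) ∨ Adj (v.1, v.2 - 1) c := by
  simp only [tip, Finset.mem_insert, Finset.mem_singleton, not_or, Prod.ext_iff] at hc
  obtain ⟨-, hc1, hc2, hc3⟩ := hc
  rw [adj_iff] at h
  rcases h with h | h | h | h | h | h
  · exact absurd h hc1
  · right; rw [adj_iff]; simp only; omega
  · exact absurd h hc2
  · exact Or.inl (Prod.ext h.1 h.2)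
  · right; rw [adj_iff]; simp only; omega
  · exact absurd h hc3

set_option maxHeartbeats 1000000 in
theorem peak_of_cap {n : ℤ} (hn : 1 ≤ n) {v w : Site} (hv : -(3 * n) ≤ v.1 ∧ v.1 ≤ 3 * n)
    (hv2 : 0 ≤ v.2 ∧ v.2 ≤ 2 * n) (hw1 : -(8 * n) + 1 ≤ w.1 ∧ w.1 ≤ 8 * n + 1)
    (hw2 : -(8 * n) - 1 ≤ w.2 ∧ w.2 ≤ 8 * n - 1) {ω η : Config} (hcap : Cap n v (tower n ω))
    (hstrip : Strip n (tower n ω) (op ω ∩ rect (-(30 * n)) (30 * n) (-(30 * n)) (30 * n)))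
    (hη : ∀ u ∈ tip v, η u = decide (u ≠ v)) :
    mix {u | u ∉ tip v} ω η ∈ Peak (v.1 - w.1 + -(16 * n)) (v.1 - w.1 + 16 * n)
      (v.2 - w.2 + -(16 * n)) (v.2 - w.2 + 16 * n) v := by
  set ω' := mix {u | u ∉ tip v} ω η with hω'
  have htip : ∀ u ∈ tip v, v.2 ≤ u.2 := by
    intro u hu
    simp only [tip, Finset.mem_insert, Finset.mem_singleton] at hu
    rcases hu with rfl | rfl | rfl | rfl <;> simp
  have hoff : ∀ u, u ∉ tip v → ω' u = ω u := fun u hu => mix_of_mem hu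
  have hon : ∀ u ∈ tip v, ω' u = decide (u ≠ v) := fun u hu =>
    (mix_of_notMem (by simpa using hu)).trans (hη u hu)
  have hvt : v ∈ tip v := by simp [tip]
  have hvcl : ω' v = false := by rw [hon v hvt]; simp
  obtain ⟨hcap, hK⟩ := hcap
  have hKcl : ∀ u ∈ tower n ω, ω' u = false := fun u hu => by
    rw [hoff u fun h => by have := htip u h; have := (hK u hu).2.2; omega]
    exact (clu_subset hu).2
  have hbelow : ∀ u, u ∉ tip v → ω' u = false → (∃ x ∈ tower n ω, Adj x u) →
      u ∈ rect (-(30 * n)) (30 * n) (-(30 * n)) (30 * n) → u ∈ tower n ω := by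
    rintro u hu hu' ⟨x, hx, hxu⟩ huW
    exact clu_step hx hxu huW ((hoff u hu).symm.trans hu')
  set B := rect (v.1 - w.1 + -(16 * n)) (v.1 - w.1 + 16 * n)
    (v.2 - w.2 + -(16 * n)) (v.2 - w.2 + 16 * n) with hB
  have hBW : B ⊆ rect (-(30 * n)) (30 * n) (-(30 * n)) (30 * n) := by
    intro u hu
    have := mem_rect.1 hu
    rw [mem_rect]; omega
  have hcapB : (v.1, v.2 - 1) ∈ B := by rw [hB, mem_rect]; simp only; omega
  constructor
  · obtain ⟨z, hz, hzv⟩ := clu_conn hcap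
    obtain ⟨u, x, hu, hux, hx, hxB⟩ := hzv.symm.exists_exit (Y := B) hcapB (fun h => by
      have := mem_rect.1 h
      have := hz.1
      omega)
    have hux' : u.2 = v.2 - w.2 + -(16 * n) := by
      have h1 := hK x hx
      have h2 := mem_rect.1 hu.mem_right.2
      rw [hB, mem_rect] at hxB
      rw [adj_iff] at hux
      omega
    refine ⟨u, hux', (hu.symm.mono (T := cl ω' ∩ B) fun y hy => ⟨hKcl y hy.1, hy.2⟩).step ?_
      ⟨hvcl, ?_⟩⟩
    · rw [adj_iff]; grind
    · rw [hB, mem_rect]; omega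
  · rintro u ⟨z, hz, hzu⟩
    have hz : z.2 = v.2 - w.2 + -(16 * n) := hz
    by_contra! ⟨hne, hle⟩
    have h1 := hzu.symm.cluster
    obtain ⟨x, hxT, hx, hux⟩ := HC.blocks hstrip (fun y (hy : Conn _ u y) => by
      have := mem_rect.1 (hBW hy.mem_right.2)
      omega) h1 (by omega) (by omega)
    have hux : Conn (cl ω' ∩ B) u x := hux
    have hxT := mem_rect.1 hxT
    have hxK : x ∈ tower n ω := by
      refine hx.resolve_left fun h => ?_
      have h2 : ω x = true := h.1
      rw [← hoff x fun h => by have := htip x h; omega] at h2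
      have h3 : ω' x = false := hux.mem_right.1
      rw [h3] at h2
      exact absurd h2 (by decide)
    have key : u ∈ tower n ω ∨ u = v := by
      refine hux.symm.induct (Or.inl hxK) fun b c _ hb hbc hc => ?_
      by_cases hct : c ∈ tip v
      · right
        have h2 := hon c hct
        rw [show ω' c = false from hc.1] at h2
        simpa using h2.symm
      · left
        rcases hb with hb | hb
        · exact hbelow c hct hc.1 ⟨b, hb, hbc⟩ (hBW hc.2)
        · rcases eq_or_adj_of_notMem_tip (hb ▸ hbc) hct with h2 | h2
          · rw [h2]; exact hcap
          · exact hbelow c hct hc.1 ⟨_, hcap, h2⟩ (hBW hc.2)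
    rcases key with h | h
    · have := (hK u h).2.2
      omega
    · exact hne h

theorem isLoc_vc_cl (a b c d : ℤ) : IsLoc {ω | VC (cl ω) a b c d} := by
  refine isLoc_of_rect a b c d fun ω ω' h hω => ?_
  refine VC.mono (O := cl ω) (fun v hv => ?_) hω
  exact (h v hv.2).symm.trans hv.1

theorem isLoc_funnel (n : ℤ) : IsLoc (funnel n) :=
  (isLoc_vc_cl _ _ _ _).inter ((isLoc_vc _ _ _ _).inter ((isLoc_vc _ _ _ _).inter
    (isLoc_hc _ _ _ _)))

theorem measure_funnel {μ : Measure Config} (hμ : IsBernoulliHalf μ) (n : ℤ) :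
    μ {ω | VC (cl ω) (-n) n (-(30 * n)) (-1)} *
      (μ {ω | VC (op ω) (n + 1) (3 * n) (-(30 * n)) (2 * n)} *
        (μ {ω | VC (op ω) (-(3 * n)) (-n - 1) (-(30 * n)) (2 * n)} *
          μ {ω | HC (op ω) (-(3 * n)) (3 * n) 0 (2 * n)})) ≤ μ (funnel n) := by
  have h1 := harris hμ (isLoc_vc (-(3 * n)) (-n - 1) (-(30 * n)) (2 * n))
    (isLoc_hc (-(3 * n)) (3 * n) 0 (2 * n)) (inc_vc _ _ _ _) (inc_hc _ _ _ _)
  have h2 := harris hμ (isLoc_vc (n + 1) (3 * n) (-(30 * n)) (2 * n))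
    ((isLoc_vc (-(3 * n)) (-n - 1) (-(30 * n)) (2 * n)).inter
      (isLoc_hc (-(3 * n)) (3 * n) 0 (2 * n))) (inc_vc _ _ _ _)
    ((inc_vc _ _ _ _).inter (inc_hc _ _ _ _))
  have h3 := indep hμ (isLoc_vc_cl (-n) n (-(30 * n)) (-1))
    ((isLoc_vc (n + 1) (3 * n) (-(30 * n)) (2 * n)).inter
      ((isLoc_vc (-(3 * n)) (-n - 1) (-(30 * n)) (2 * n)).inter
        (isLoc_hc (-(3 * n)) (3 * n) 0 (2 * n)))) (rect (-n) n (-(30 * n)) (-1)) ?_ ?_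
  · refine le_trans ?_ h3
    gcongr
    refine le_trans ?_ h2
    gcongr
  · intro ω ω' h hω
    exact VC.mono (O := cl ω) (fun v hv => (h v hv.2).symm.trans hv.1) hω
  · rintro ω ω' h ⟨hω1, hω2, hω3⟩
    refine ⟨VC.mono (O := op ω) (fun v hv => ?_) hω1, VC.mono (O := op ω) (fun v hv => ?_) hω2,
      HC.mono (O := op ω) (fun v hv => ?_) hω3⟩ <;>
    · refine (h v fun hv' => ?_).symm.trans hv.1
      have h1 := mem_rect.1 hv.2
      have h2 := mem_rect.1 hv'
      omega

theorem measure_funnel_strip {μ : Measure Config} (hμ : IsBernoulliHalf μ) {n : ℤ} (hn : 1 ≤ n) :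
    μ (funnel n) * μ {ω | HC (op ω) (-(30 * n)) (30 * n) (-(6 * n) + 2) (-2)} ≤
      μ {ω | Tall n (tower n ω) ∧ Strip n (tower n ω)
        (op ω ∩ rect (-(30 * n)) (30 * n) (-(30 * n)) (30 * n))} := by
  refine resample hμ (isLoc_funnel n) (isLoc_hc _ _ _ _)
    (isLoc_of_clu subset_rfl fun K O => Tall n K ∧ Strip n K O)
    (expl (rect (-(30 * n)) (30 * n) (-(30 * n)) (30 * n)) (base n))
    (fun _ _ h => expl_congr h) fun ω hω η hη => ?_
  set E := expl (rect (-(30 * n)) (30 * n) (-(30 * n)) (30 * n)) (base n) ω with hE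
  have h1 : tower n (mix E ω η) = tower n ω := clu_congr fun v hv => mix_of_mem hv
  rw [Set.mem_ofPred_eq, h1]
  refine ⟨⟨exists_mem_tower hω, fun v => tower_bounded hn hω⟩, HC.mono (O := op η) ?_ hη⟩
  intro v hv
  by_cases hK : v ∈ tower n ω
  · exact Or.inr hK
  · refine Or.inl ⟨?_, ?_⟩
    · by_cases hvE : v ∈ E
      · exact (mix_of_mem hvE).trans (expl_open hvE hK)
      · exact (mix_of_notMem hvE).trans hv.1
    · have := mem_rect.1 hv.2
      rw [mem_rect]; omega

theorem card_tip (v : Site) : (tip v).card = 4 := by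
  rw [tip, Finset.card_insert_of_notMem, Finset.card_insert_of_notMem,
    Finset.card_insert_of_notMem, Finset.card_singleton] <;>
  simp only [Finset.mem_insert, Finset.mem_singleton, Prod.ext_iff] <;> omega

theorem measure_cap_le {μ : Measure Config} (hμ : IsBernoulliHalf μ) {n : ℤ} (hn : 1 ≤ n)
    {v w : Site} (hv : -(3 * n) ≤ v.1 ∧ v.1 ≤ 3 * n) (hv2 : 0 ≤ v.2 ∧ v.2 ≤ 2 * n)
    (hw1 : -(8 * n) + 1 ≤ w.1 ∧ w.1 ≤ 8 * n + 1) (hw2 : -(8 * n) - 1 ≤ w.2 ∧ w.2 ≤ 8 * n - 1) :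
    μ {ω | Cap n v (tower n ω) ∧ Strip n (tower n ω)
        (op ω ∩ rect (-(30 * n)) (30 * n) (-(30 * n)) (30 * n))} ≤
      16 * μ (Peak (-(16 * n)) (16 * n) (-(16 * n)) (16 * n) w) := by
  have h1 : IsLoc {η : Config | ∀ u ∈ tip v, η u = decide (u ≠ v)} :=
    ⟨tip v, fun ω ω' h hω u hu => (h u hu).symm.trans (hω u hu)⟩
  have h2 := resample hμ (isLoc_of_clu (S := rect (-(30 * n)) (30 * n) (-(30 * n)) (30 * n))
    (Z := base n) subset_rfl fun K O => Cap n v K ∧ Strip n K O) h1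
    (isLoc_peak (v.1 - w.1 + -(16 * n)) (v.1 - w.1 + 16 * n)
      (v.2 - w.2 + -(16 * n)) (v.2 - w.2 + 16 * n) v) (fun _ => {u | u ∉ tip v})
    (fun _ _ _ => rfl) fun ω hω η hη => peak_of_cap hn hv hv2 hw1 hw2 hω.1 hω.2 hη
  have h3 := measure_peak_shift hμ (-(16 * n)) (16 * n) (-(16 * n)) (16 * n) w (v - w)
  rw [sub_add_cancel, Prod.fst_sub, Prod.snd_sub] at h3
  rw [h3, hμ.2, card_tip] at h2
  have h4 : (16 : ℝ≥0∞) * (1 / 2) ^ 4 = 1 := by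
    have := two_pow_mul_half_pow 4
    norm_num at this ⊢
    exact this
  calc _ = 16 * (μ _ * (1 / 2) ^ 4) := by rw [mul_left_comm, h4, mul_one]
    _ ≤ _ := by gcongr; exact h2

/-- The probability of a peak at a given site of the bulk is at least of order `n⁻²`. -/
theorem peak_lower_bound : ∃ c : ℝ≥0∞, c ≠ 0 ∧ ∀ μ : Measure Config, IsBernoulliHalf μ →
    ∀ n : ℕ, 1 ≤ n → ∀ w : Site, -(8 * (n : ℤ)) + 1 ≤ w.1 ∧ w.1 ≤ 8 * (n : ℤ) + 1 →
      -(8 * (n : ℤ)) - 1 ≤ w.2 ∧ w.2 ≤ 8 * (n : ℤ) - 1 →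
      c ≤ n ^ 2 * μ (Peak (-(16 * (n : ℤ))) (16 * n) (-(16 * (n : ℤ))) (16 * n) w) := by
  obtain ⟨c, hc0, hc⟩ := crossing_bounds 20
  refine ⟨c * (c * (c * c)) * c / 336, ?_, fun μ hμ N hN w hw1 hw2 => ?_⟩
  · simp [ENNReal.div_eq_zero_iff, hc0]
  rw [ENNReal.div_le_iff' (by norm_num) (by norm_num)]
  set n : ℤ := (N : ℤ) with hn
  have hn1 : 1 ≤ n := by omega
  set p := μ (Peak (-(16 * n)) (16 * n) (-(16 * n)) (16 * n) w) with hp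
  have h1 := (hc μ hμ (-n) n (-(30 * n)) (-1) (by omega) (by omega)).2.2 (by omega)
  have h2 := (hc μ hμ (n + 1) (3 * n) (-(30 * n)) (2 * n) (by omega) (by omega)).2.1 (by omega)
  have h3 := (hc μ hμ (-(3 * n)) (-n - 1) (-(30 * n)) (2 * n) (by omega) (by omega)).2.1 (by omega)
  have h4 := (hc μ hμ (-(3 * n)) (3 * n) 0 (2 * n) (by omega) (by omega)).1 (by omega)
  have h5 := (hc μ hμ (-(30 * n)) (30 * n) (-(6 * n) + 2) (-2) (by omega) (by omega)).1 (by omega)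
  set R := Finset.Icc (-(3 * n)) (3 * n) ×ˢ Finset.Icc 0 (2 * n) with hR
  have hcard : R.card ≤ 21 * N ^ 2 := by
    rw [hR, Finset.card_product, Int.card_Icc, Int.card_Icc]
    have e1 : (3 * n + 1 - -(3 * n)).toNat = 6 * N + 1 := by omega
    have e2 : (2 * n + 1 - 0).toNat = 2 * N + 1 := by omega
    rw [e1, e2]
    nlinarith
  calc c * (c * (c * c)) * c
      ≤ μ (funnel n) * μ {ω | HC (op ω) (-(30 * n)) (30 * n) (-(6 * n) + 2) (-2)} := by
        gcongr
        refine le_trans ?_ (measure_funnel hμ n)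
        gcongr
    _ ≤ _ := measure_funnel_strip hμ hn1
    _ ≤ μ (⋃ v ∈ R, {ω | Cap n v (tower n ω) ∧ Strip n (tower n ω)
        (op ω ∩ rect (-(30 * n)) (30 * n) (-(30 * n)) (30 * n))}) := by
        refine measure_mono fun ω hω => ?_
        obtain ⟨v, hv, hcap⟩ := exists_cap hω.1
        simp only [Set.mem_iUnion]
        exact ⟨v, hv, hcap, hω.2⟩
    _ ≤ ∑ v ∈ R, μ {ω | Cap n v (tower n ω) ∧ Strip n (tower n ω)
        (op ω ∩ rect (-(30 * n)) (30 * n) (-(30 * n)) (30 * n))} := measure_biUnion_finset_le _ _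
    _ ≤ ∑ _v ∈ R, 16 * p := by
        refine Finset.sum_le_sum fun v hv => ?_
        simp only [hR, Finset.mem_product, Finset.mem_Icc] at hv
        exact measure_cap_le hμ hn1 hv.1 hv.2 hw1 hw2
    _ = R.card * (16 * p) := by rw [Finset.sum_const, nsmul_eq_mul]
    _ ≤ ((21 * N ^ 2 : ℕ) : ℝ≥0∞) * (16 * p) := by gcongr
    _ = 336 * (N ^ 2 * p) := by push_cast; ring

/-- A barrier around the square of side `m` with lower left corner `w`. -/
def Barrier (m : ℤ) (w : Site) (O : Set Site) : Prop :=
  VC O (w.1 - 2 * m) (w.1 - 1) (w.2 - 2 * m - 1) (w.2 + m) ∧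
    VC O (w.1 + m) (w.1 + 3 * m) (w.2 - 2 * m - 1) (w.2 + m) ∧
      HC O (w.1 - 2 * m) (w.1 + 3 * m) (w.2 - 2 * m) w.2

/-- The set `K` has the unique highest site `v` and reaches the left, right or bottom side. -/
def Lead (a b c : ℤ) (v : Site) (K : Set Site) : Prop :=
  v ∈ K ∧ (∀ u ∈ K, u = v ∨ u.2 < v.2) ∧ ∃ e ∈ K, e.1 = a ∨ e.1 = b ∨ e.2 = c

theorem Barrier.mono {m : ℤ} {w : Site} {O O' Λ : Set Site} (h : Barrier m w O)
    (hΛ : rect (w.1 - 2 * m) (w.1 + 3 * m) (w.2 - 2 * m - 1) (w.2 + m) ⊆ Λ)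
    (hO : O ∩ Λ ⊆ O') : Barrier m w O' := by
  refine ⟨h.1.mono fun v hv => ?_, h.2.1.mono fun v hv => ?_, h.2.2.mono fun v hv => ?_⟩ <;>
  · refine hO ⟨hv.1, hΛ ?_⟩
    have := mem_rect.1 hv.2
    rw [mem_rect]; omega

theorem Barrier.blocks {m : ℤ} {w : Site} {O K : Set Site} (h : Barrier m w O) {v e : Site}
    (hv1 : w.1 ≤ v.1 ∧ v.1 < w.1 + m) (hv2 : w.2 ≤ v.2 ∧ v.2 < w.2 + m)
    (hK : ∀ u ∈ K, u.2 ≤ v.2) (hve : Conn K v e)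
    (he : e.1 < w.1 - 2 * m ∨ w.1 + 3 * m < e.1 ∨ e.2 < w.2 - 2 * m) :
    ∃ x, x ∈ O ∧ x ∈ K := by
  obtain ⟨u, x, hvu, hux, hx, hxY⟩ := hve.exists_exit
    (Y := {v | w.1 - 2 * m ≤ v.1 ∧ v.1 ≤ w.1 + 3 * m ∧ w.2 - 2 * m ≤ v.2})
    (show _ ∧ _ ∧ _ by omega) (fun h => by have := h.1; have := h.2.1; have := h.2.2; omega)
  set Y : Set Site := {v | w.1 - 2 * m ≤ v.1 ∧ v.1 ≤ w.1 + 3 * m ∧ w.2 - 2 * m ≤ v.2} with hY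
  have hu : w.1 - 2 * m ≤ u.1 ∧ u.1 ≤ w.1 + 3 * m ∧ w.2 - 2 * m ≤ u.2 := hvu.mem_right.2
  have hxY : ¬ (w.1 - 2 * m ≤ x.1 ∧ x.1 ≤ w.1 + 3 * m ∧ w.2 - 2 * m ≤ x.2) := hxY
  set Q : Set Site := K ∩ Y ∪ {x} with hQ
  have hvx : Conn Q v x :=
    (hvu.mono (T := Q) Set.subset_union_left).step hux (Or.inr rfl)
  have hQK : ∀ y ∈ Q, y ∈ K := by
    rintro y (hy | rfl)
    exacts [hy.1, hx]
  have hxu := adj_iff.1 hux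
  have hlev : ∀ y ∈ Q, w.2 - 2 * m - 1 ≤ y.2 ∧ y.2 ≤ w.2 + m := by
    intro y hy
    have h1 := hK y (hQK y hy)
    rcases hy with hy | rfl
    · have := hy.2.2.2
      omega
    · omega
  rcases lt_or_ge x.1 (w.1 - 2 * m) with h1 | h1
  · obtain ⟨y, -, hy, hy'⟩ := h.1.blocks hlev hvx.symm h1 (by omega)
    exact ⟨y, hy, hQK y hy'⟩
  rcases lt_or_ge (w.1 + 3 * m) x.1 with h2 | h2
  · obtain ⟨y, -, hy, hy'⟩ := h.2.1.blocks hlev hvx (by omega) h2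
    exact ⟨y, hy, hQK y hy'⟩
  obtain ⟨y, -, hy, hy'⟩ := h.2.2.blocks (Q := Q) (fun y hy => by
    rcases hy with hy | rfl
    · have := hy.2.1
      have := hy.2.2.1
      omega
    · omega) hvx hv2.1 (by omega)
  exact ⟨y, hy, hQK y hy'⟩

theorem isLoc_barrier (m : ℤ) (w : Site) : IsLoc {ω | Barrier m w (op ω)} := by
  refine isLoc_of_rect (w.1 - 2 * m) (w.1 + 3 * m) (w.2 - 2 * m - 1) (w.2 + m)
    fun ω ω' h hω => ?_
  exact Barrier.mono (O := op ω) hω subset_rfl fun v hv => (h v hv.2).symm.trans hv.1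

theorem measure_barrier {μ : Measure Config} (hμ : IsBernoulliHalf μ) (m : ℤ) (w : Site) :
    μ {ω | VC (op ω) (w.1 - 2 * m) (w.1 - 1) (w.2 - 2 * m - 1) (w.2 + m)} *
      (μ {ω | VC (op ω) (w.1 + m) (w.1 + 3 * m) (w.2 - 2 * m - 1) (w.2 + m)} *
        μ {ω | HC (op ω) (w.1 - 2 * m) (w.1 + 3 * m) (w.2 - 2 * m) w.2}) ≤
      μ {ω | Barrier m w (op ω)} := by
  have h1 := harris hμ (isLoc_vc (w.1 + m) (w.1 + 3 * m) (w.2 - 2 * m - 1) (w.2 + m))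
    (isLoc_hc (w.1 - 2 * m) (w.1 + 3 * m) (w.2 - 2 * m) w.2) (inc_vc _ _ _ _) (inc_hc _ _ _ _)
  have h2 := harris hμ (isLoc_vc (w.1 - 2 * m) (w.1 - 1) (w.2 - 2 * m - 1) (w.2 + m))
    ((isLoc_vc (w.1 + m) (w.1 + 3 * m) (w.2 - 2 * m - 1) (w.2 + m)).inter
      (isLoc_hc (w.1 - 2 * m) (w.1 + 3 * m) (w.2 - 2 * m) w.2)) (inc_vc _ _ _ _)
    ((inc_vc _ _ _ _).inter (inc_hc _ _ _ _))
  exact le_trans (by gcongr) h2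

/-- A closed cluster with highest site `v`, and a barrier that only the cluster can cross. -/
def Sealed (m n : ℤ) (w v : Site) : Set Config :=
  {ω | Lead (m - n) n (m - n) v (clu (rect (m - n) n (m - n) n) {v} ω) ∧
    Barrier m w (op ω ∩ rect (m - n) n (m - n) n ∪ clu (rect (m - n) n (m - n) n) {v} ω)}

theorem isLoc_sealed (m n : ℤ) (w v : Site) : IsLoc (Sealed m n w v) :=
  isLoc_of_clu (S := rect (m - n) n (m - n) n) (Z := {v}) subset_rfl
    fun K O => Lead (m - n) n (m - n) v K ∧ Barrier m w (O ∪ K)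

theorem mul_measure_lead_le {μ : Measure Config} (hμ : IsBernoulliHalf μ) {m n : ℤ}
    {w : Site} (v : Site)
    (hΛ : rect (w.1 - 2 * m) (w.1 + 3 * m) (w.2 - 2 * m - 1) (w.2 + m) ⊆
      rect (m - n) n (m - n) n) :
    μ {ω | Lead (m - n) n (m - n) v (clu (rect (m - n) n (m - n) n) {v} ω)} *
      μ {ω | Barrier m w (op ω)} ≤ μ (Sealed m n w v) := by
  refine resample hμ (isLoc_of_clu (S := rect (m - n) n (m - n) n) (Z := {v}) subset_rfl
    fun K _ => Lead (m - n) n (m - n) v K) (isLoc_barrier m w) (isLoc_sealed m n w v)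
    (fun ω => expl (rect (m - n) n (m - n) n) {v} ω) (fun _ _ h => expl_congr h)
    fun ω hω η hη => ?_
  rw [Sealed, Set.mem_ofPred_eq, clu_congr (ω := ω) fun _ hv => mix_of_mem hv]
  refine ⟨hω, Barrier.mono hη hΛ fun u hu => ?_⟩
  by_cases huK : u ∈ clu (rect (m - n) n (m - n) n) {v} ω
  · exact Or.inr huK
  · refine Or.inl ⟨?_, hu.2⟩
    by_cases huE : u ∈ expl (rect (m - n) n (m - n) n) {v} ω
    · exact (mix_of_mem huE).trans (expl_open huE huK)
    · exact (mix_of_notMem huE).trans hu.1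

theorem clu_singleton_symm {S : Set Site} {ω : Config} {u v x : Site} (hu : x ∈ clu S {u} ω)
    (hv : x ∈ clu S {v} ω) : u ∈ clu S {v} ω := by
  obtain ⟨_, rfl, hu⟩ := hu
  obtain ⟨_, rfl, hv⟩ := hv
  exact ⟨_, rfl, hv.trans hu.symm⟩

theorem eq_of_mem_sealed {m n : ℤ} {w v v' : Site}
    (hΛ1 : m - n < w.1 - 2 * m) (hΛ2 : w.1 + 3 * m < n) (hΛ3 : m - n < w.2 - 2 * m)
    (hv1 : w.1 ≤ v'.1 ∧ v'.1 < w.1 + m) (hv2 : w.2 ≤ v'.2 ∧ v'.2 < w.2 + m)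
    {ω : Config} (h : ω ∈ Sealed m n w v) (h' : ω ∈ Sealed m n w v') : v = v' := by
  obtain ⟨⟨-, hmax, -⟩, hB⟩ := h
  obtain ⟨⟨-, hmax', e, he, hend⟩, -⟩ := h'
  obtain ⟨_, rfl, hve⟩ := clu_conn he
  obtain ⟨x, hx, hx'⟩ := hB.blocks hv1 hv2 (fun u hu => by
    rcases hmax' u hu with rfl | h
    exacts [le_rfl, h.le]) hve (by omega)
  have hx := hx.resolve_left fun h => notMem_op_of_clu hx' h.1
  have h1 := hmax _ (clu_singleton_symm hx' hx)
  have h2 := hmax' _ (clu_singleton_symm hx hx')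
  rcases h1 with h1 | h1
  · exact h1.symm
  · rcases h2 with h2 | h2
    · exact h2
    · omega

theorem peak_subset_lead {m n : ℤ} {w s : Site} (hs1 : 0 ≤ s.1 ∧ s.1 < m)
    (hs2 : 0 ≤ s.2 ∧ s.2 < m) (hX : s + w ∈ rect (m - n) n (m - n) n) (hw : s.2 + w.2 < n) :
    Peak (s.1 + -n) (s.1 + n) (s.2 + -n) (s.2 + n) (s + w) ⊆
      {ω | Lead (m - n) n (m - n) (s + w) (clu (rect (m - n) n (m - n) n) {s + w} ω)} := by
  intro ω hω
  obtain ⟨hv, hmax⟩ := hω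
  have hcl := (clu_subset hv).2
  set X := rect (m - n) n (m - n) n with hXdef
  set B := rect (s.1 + -n) (s.1 + n) (s.2 + -n) (s.2 + n) with hBdef
  have hXB : X ⊆ B := by
    intro u hu
    have := mem_rect.1 hu
    rw [hBdef, mem_rect]; omega
  have hself : s + w ∈ clu X {s + w} ω := clu_start rfl hX hcl
  have hsub : clu X {s + w} ω ⊆ clu B {v | v.2 = s.2 + -n} ω := by
    rintro u ⟨_, rfl, hu⟩
    obtain ⟨z, hz, hzv⟩ := hv
    exact ⟨z, hz, hzv.trans (Conn.mono (T := cl ω ∩ B) (fun y hy => ⟨hy.1, hXB hy.2⟩) hu)⟩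
  refine ⟨hself, fun u hu => hmax u (hsub hu), ?_⟩
  obtain ⟨z, hz, hzv⟩ := clu_conn hv
  have hz : z.2 = s.2 + -n := hz
  obtain ⟨u, x, hvu, hux, hx, hxX⟩ := hzv.symm.exists_exit (Y := X) hX (fun h => by
    have := mem_rect.1 h
    omega)
  refine ⟨u, ⟨_, rfl, Conn.mono (T := cl ω ∩ X) (fun y hy => ⟨(clu_subset hy.1).2, hy.2⟩) hvu⟩, ?_⟩
  have hxle : x.2 < n := by
    rcases hmax x hx with rfl | h
    · exact hw
    · exact h.trans hw
  have hu := mem_rect.1 hvu.mem_right.2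
  rw [hXdef, mem_rect] at hxX
  rw [adj_iff] at hux
  omega

/-- The probability of a peak at a given site of the bulk is at most of order `n⁻²`. -/
theorem peak_upper_bound : ∃ c : ℝ≥0∞, c ≠ 0 ∧ ∀ μ : Measure Config, IsBernoulliHalf μ →
    ∀ n : ℕ, 16 ≤ n → ∀ w : Site, 2 * |w.1 - 1| ≤ (n : ℤ) → 2 * |w.2 + 1| ≤ (n : ℤ) →
      c * (n ^ 2 * μ (Peak (-(n : ℤ)) n (-(n : ℤ)) n w)) ≤ 1 := by
  obtain ⟨c, hc0, hc⟩ := crossing_bounds 3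
  refine ⟨c * (c * c) / 1024, by simp [ENNReal.div_eq_zero_iff, hc0],
    fun μ hμ N hN w hw1 hw2 => ?_⟩
  set M := N / 16 with hM
  have hM1 : 1 ≤ M := by omega
  have hN32 : N ≤ 32 * M := by omega
  have hMN : 16 * M ≤ N := by omega
  obtain ⟨m, hm⟩ : ∃ m : ℤ, m = M := ⟨_, rfl⟩
  obtain ⟨n, hn⟩ : ∃ n : ℤ, n = N := ⟨_, rfl⟩
  rw [← hn] at hw1 hw2 ⊢
  have hw1 := abs_le.1 (show |w.1 - 1| ≤ n / 2 by omega)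
  have hw2 := abs_le.1 (show |w.2 + 1| ≤ n / 2 by omega)
  have hΛ : rect (w.1 - 2 * m) (w.1 + 3 * m) (w.2 - 2 * m - 1) (w.2 + m) ⊆
      rect (m - n) n (m - n) n := by
    intro u hu
    have := mem_rect.1 hu
    rw [mem_rect]; omega
  set p := μ (Peak (-n) n (-n) n w) with hp
  have hbar : c * (c * c) ≤ μ {ω | Barrier m w (op ω)} := by
    refine le_trans ?_ (measure_barrier hμ m w)
    gcongr
    · exact (hc μ hμ _ _ _ _ (by omega) (by omega)).2.1 (by push_cast; omega)
    · exact (hc μ hμ _ _ _ _ (by omega) (by omega)).2.1 (by push_cast; omega)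
    · exact (hc μ hμ _ _ _ _ (by omega) (by omega)).1 (by push_cast; omega)
  set R := Finset.Ico 0 m ×ˢ Finset.Ico 0 m with hR
  have hmem : ∀ s ∈ R, (0 ≤ s.1 ∧ s.1 < m) ∧ (0 ≤ s.2 ∧ s.2 < m) := fun s hs => by
    simpa [hR] using hs
  have hcard : R.card = M ^ 2 := by
    rw [hR, Finset.card_product, Int.card_Ico]
    have : (m - 0).toNat = M := by omega
    rw [this, sq]
  have hone : ∀ s ∈ R, p * (c * (c * c)) ≤ μ (Sealed m n w (s + w)) := fun s hs => by
    obtain ⟨hs1, hs2⟩ := hmem s hs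
    refine le_trans ?_ (mul_measure_lead_le hμ (s + w) hΛ)
    rw [hp, ← measure_peak_shift hμ (-n) n (-n) n w s]
    gcongr
    refine peak_subset_lead hs1 hs2 ?_ (by omega)
    rw [mem_rect, Prod.fst_add, Prod.snd_add]
    omega
  have hdisj : Set.PairwiseDisjoint (R : Set Site) fun s => Sealed m n w (s + w) := by
    intro s hs t ht hst
    refine Set.disjoint_left.2 fun ω h h' => hst ?_
    obtain ⟨ht1, ht2⟩ := hmem t ht
    have := eq_of_mem_sealed (by omega) (by omega) (by omega)
      (by rw [Prod.fst_add]; omega) (by rw [Prod.snd_add]; omega) h h'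
    exact add_right_cancel this
  have hsum : (M : ℝ≥0∞) ^ 2 * (p * (c * (c * c))) ≤ 1 := by
    calc (M : ℝ≥0∞) ^ 2 * (p * (c * (c * c))) = ∑ _s ∈ R, p * (c * (c * c)) := by
          rw [Finset.sum_const, hcard, nsmul_eq_mul]; push_cast; rfl
      _ ≤ ∑ s ∈ R, μ (Sealed m n w (s + w)) := Finset.sum_le_sum hone
      _ = μ (⋃ s ∈ R, Sealed m n w (s + w)) :=
          (measure_biUnion_finset hdisj fun s _ => (isLoc_sealed m n w (s + w)).measurableSet).symm
      _ ≤ 1 := by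
          have := hμ.1
          exact prob_le_one
  calc c * (c * c) / 1024 * (N ^ 2 * p) ≤ c * (c * c) / 1024 * ((32 * M : ℕ) ^ 2 * p) := by
        gcongr
    _ = (M : ℝ≥0∞) ^ 2 * (p * (c * (c * c))) * (1024 / 1024) := by
        push_cast
        rw [div_eq_mul_inv, div_eq_mul_inv]; ring
    _ ≤ 1 := by
        rw [ENNReal.div_self (by norm_num) (by norm_num), mul_one]
        exact hsum

end TriPerc

/-- There exists a constant `C < ∞` such that for all integers `n ≥ 1`, all
`y ∈ B(n/2)`, and all `ỹ ∈ B(8n)`, `P(U(y, B(n))) ≤ C·P(U(ỹ, B(16n)))`. -/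
theorem statement17 :
    ∃ C : ℝ≥0∞, C < ⊤ ∧
      ∀ μ : Measure Config, IsBernoulliHalf μ →
        ∀ n : ℕ, 1 ≤ n →
          ∀ y yt : Site, 2 * |y.1| ≤ (n : ℤ) → 2 * |y.2| ≤ (n : ℤ) →
            |yt.1| ≤ (8 * n : ℤ) → |yt.2| ≤ (8 * n : ℤ) →
            μ {ω | ∃ p, IsLowestCrossing (-(n : ℤ)) n (-(n : ℤ)) n ω p ∧
                HighestPair p y} ≤
              C * μ {ω | ∃ p,
                  IsLowestCrossing (-(16 * n : ℤ)) (16 * n) (-(16 * n : ℤ)) (16 * n) ω p ∧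
                    HighestPair p yt} := by
  obtain ⟨a, ha0, ha⟩ := TriPerc.peak_lower_bound
  obtain ⟨b, hb0, hb⟩ := TriPerc.peak_upper_bound
  refine ⟨(b⁻¹ + 256) * a⁻¹, ENNReal.mul_lt_top
    (ENNReal.add_lt_top.2 ⟨ENNReal.inv_lt_top.2 (pos_iff_ne_zero.2 hb0), by norm_num⟩)
    (ENNReal.inv_lt_top.2 (pos_iff_ne_zero.2 ha0)), fun μ hμ n hn y yt hy1 hy2 ht1 ht2 => ?_⟩
  have := hμ.1
  rw [abs_le] at ht1 ht2
  have hA := ha μ hμ n hn (yt.1 + 1, yt.2 - 1) (by dsimp only; omega) (by dsimp only; omega)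
  set u := μ {ω | ∃ p, IsLowestCrossing (-(n : ℤ)) n (-(n : ℤ)) n ω p ∧ HighestPair p y}
  set v := μ {ω | ∃ p, IsLowestCrossing (-(16 * n : ℤ)) (16 * n) (-(16 * n : ℤ)) (16 * n) ω p ∧
    HighestPair p yt} with hv
  have hv' : a ≤ n ^ 2 * v := by
    refine hA.trans ?_
    rw [hv]
    gcongr
    intro ω hω
    have := TriPerc.exists_lowest_of_peak (by dsimp only; omega) (by dsimp only; omega) hω
    simpa using this
  have h1 : 1 ≤ a⁻¹ * (n ^ 2 * v) := by
    have hat : a ≠ ⊤ := ne_top_of_le_ne_top (by finiteness) hv'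
    rw [← ENNReal.inv_mul_cancel ha0 hat]
    gcongr
  rcases lt_or_ge n 16 with h | h
  · calc u ≤ 1 := prob_le_one
      _ ≤ a⁻¹ * (n ^ 2 * v) := h1
      _ ≤ a⁻¹ * ((16 : ℕ) ^ 2 * v) := by gcongr
      _ = 256 * a⁻¹ * v := by push_cast; ring
      _ ≤ (b⁻¹ + 256) * a⁻¹ * v := by gcongr; exact le_add_self
  · have hB := hb μ hμ n h (y.1 + 1, y.2 - 1) (by simpa using hy1) (by simpa using hy2)
    set q := μ (TriPerc.Peak (-(n : ℤ)) n (-(n : ℤ)) n (y.1 + 1, y.2 - 1))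
    have hy1 := abs_le.1 (show |y.1| ≤ n / 2 by omega)
    have hy2 := abs_le.1 (show |y.2| ≤ n / 2 by omega)
    have huq : u ≤ q := measure_mono fun ω ⟨p, hp, hp'⟩ =>
      TriPerc.peak_of_lowest (by omega) (by omega) (by omega) hp hp'
    calc u ≤ q * (a⁻¹ * (n ^ 2 * v)) := huq.trans (le_mul_of_one_le_right' h1)
      _ = n ^ 2 * q * a⁻¹ * v := by ring
      _ ≤ (b⁻¹ + 256) * a⁻¹ * v := by
        gcongr
        rw [mul_comm] at hB
        exact (ENNReal.le_inv_iff_mul_le.2 hB).trans le_self_add
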